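/- arXiv:2508.12789 — 3 statements merged into one kernel-verified Lean document; each statement's English description precedes it below -/
import Mathlib

section
/- For every integer n ≥ 25 and every integer t satisfying 8t ≥ n² + 4n − 16 (i.e., t ≥ n²/8 + n/2 − 2) and 16t ≤ 5n² − 48n + 205 (i.e., t ≤ n²/4 + n²/16 − 3n + 12 + 13/16), there exists a saturated blocker of the convex n-gon consisting of exactly t edges. -/
open Finset

namespace ConvexBlocker

/-- `c` lies strictly inside the (positively oriented) open arc from `a` to `b`. -/
def Btw (n : ℕ) (a c b : ZMod n) : Prop :=
  0 < (c - a).val ∧ (c - a).val < (b - a).val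

/-- Two edges of the convex `n`-gon cross: their endpoints are four pairwise distinct
vertices which interleave in the cyclic order. -/
def Cross (n : ℕ) (e f : Sym2 (ZMod n)) : Prop :=
  ∃ a b c d : ZMod n, e = s(a, b) ∧ f = s(c, d) ∧
    0 < (c - a).val ∧ (c - a).val < (b - a).val ∧ (b - a).val < (d - a).val

/-- `e` is an edge (an unordered pair of distinct vertices) of the `n`-gon. -/
def IsEdge (n : ℕ) (e : Sym2 (ZMod n)) : Prop :=
  ∃ a b : ZMod n, e = s(a, b) ∧ a ≠ b

/-- `e` is a diagonal of the convex `n`-gon: an edge of order at least 2, i.e. both open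
arcs between its endpoints are nonempty. -/
def IsDiagonal (n : ℕ) (e : Sym2 (ZMod n)) : Prop :=
  ∃ a b : ZMod n, e = s(a, b) ∧ a ≠ b ∧ (∃ c, Btw n a c b) ∧ (∃ d, Btw n b d a)

/-- A triangulation of the convex `n`-gon: an inclusion-maximal set of pairwise
non-crossing diagonals. -/
def IsTriangulation (n : ℕ) (T : Finset (Sym2 (ZMod n))) : Prop :=
  (∀ e ∈ T, IsDiagonal n e) ∧
  (∀ e ∈ T, ∀ f ∈ T, ¬ Cross n e f) ∧
  (∀ e, IsDiagonal n e → e ∉ T → ∃ f ∈ T, Cross n e f)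

/-- A blocker of the convex `n`-gon: a set of edges meeting every triangulation. -/
def IsBlocker (n : ℕ) (B : Finset (Sym2 (ZMod n))) : Prop :=
  (∀ e ∈ B, IsEdge n e) ∧
  ∀ T : Finset (Sym2 (ZMod n)), IsTriangulation n T → (B ∩ T).Nonempty

/-- A saturated blocker of the convex `n`-gon. -/
def IsSaturatedBlocker (n : ℕ) (B : Finset (Sym2 (ZMod n))) : Prop :=
  IsBlocker n B ∧ ∀ e ∈ B, ¬ IsBlocker n (B.erase e)

/-- `e` is an edge of the sub-polygon on the vertex set `S`. -/
def IsEdgeOn (n : ℕ) (S : Finset (ZMod n)) (e : Sym2 (ZMod n)) : Prop :=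
  ∃ a b : ZMod n, e = s(a, b) ∧ a ∈ S ∧ b ∈ S ∧ a ≠ b

/-- `e` is a diagonal of the sub-polygon on `S` (with the inherited cyclic order):
its endpoints are distinct members of `S` which are not cyclically consecutive in `S`. -/
def IsDiagonalOn (n : ℕ) (S : Finset (ZMod n)) (e : Sym2 (ZMod n)) : Prop :=
  ∃ a b : ZMod n, e = s(a, b) ∧ a ∈ S ∧ b ∈ S ∧ a ≠ b ∧
    (∃ c ∈ S, Btw n a c b) ∧ (∃ d ∈ S, Btw n b d a)

/-- A triangulation of the sub-polygon on `S`. -/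
def IsTriangulationOn (n : ℕ) (S : Finset (ZMod n)) (T : Finset (Sym2 (ZMod n))) : Prop :=
  (∀ e ∈ T, IsDiagonalOn n S e) ∧
  (∀ e ∈ T, ∀ f ∈ T, ¬ Cross n e f) ∧
  (∀ e, IsDiagonalOn n S e → e ∉ T → ∃ f ∈ T, Cross n e f)

/-- A blocker of the sub-polygon on `S`. -/
def IsBlockerOn (n : ℕ) (S : Finset (ZMod n)) (B : Finset (Sym2 (ZMod n))) : Prop :=
  (∀ e ∈ B, IsEdgeOn n S e) ∧
  ∀ T : Finset (Sym2 (ZMod n)), IsTriangulationOn n S T → (B ∩ T).Nonempty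

/-- A saturated blocker of the sub-polygon on `S`. -/
def IsSaturatedBlockerOn (n : ℕ) (S : Finset (ZMod n)) (B : Finset (Sym2 (ZMod n))) : Prop :=
  IsBlockerOn n S B ∧ ∀ e ∈ B, ¬ IsBlockerOn n S (B.erase e)

/-- The degree of the vertex `v` in the set of edges `B`. -/
noncomputable def degB (n : ℕ) (B : Finset (Sym2 (ZMod n))) (v : ZMod n) : ℕ :=
  (B.filter (fun e => v ∈ e)).card

end ConvexBlocker

namespace ConvexBlocker

/-! ### Chords of the polygon as pairs of natural numbers -/

/-- The edge of the `n`-gon joining the vertices `x.1` and `x.2`. -/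
def chord (n : ℕ) (x : ℕ × ℕ) : Sym2 (ZMod n) := s((x.1 : ZMod n), (x.2 : ZMod n))

lemma val_natCast_sub {n a c : ℕ} (ha : a < n) (hc : c < n) :
    ((c : ZMod n) - (a : ZMod n)).val = if a ≤ c then c - a else n + c - a := by
  split_ifs with h
  · rw [← Nat.cast_sub h, ZMod.val_cast_of_lt (by omega)]
  · have : (c : ZMod n) - (a : ZMod n) = ((n + c - a : ℕ) : ZMod n) := by
      rw [Nat.cast_sub (by omega)]; simp
    rw [this, ZMod.val_cast_of_lt (by omega)]

lemma exists_natCast_eq {n : ℕ} (hn : 0 < n) (v : ZMod n) : ∃ a < n, v = (a : ZMod n) := by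
  have : NeZero n := ⟨hn.ne'⟩
  exact ⟨v.val, v.val_lt, (ZMod.natCast_zmod_val v).symm⟩

lemma natCast_inj {n a b : ℕ} (ha : a < n) (hb : b < n) :
    (a : ZMod n) = (b : ZMod n) ↔ a = b := by
  refine ⟨fun h => ?_, fun h => h ▸ rfl⟩
  simpa [ZMod.val_cast_of_lt ha, ZMod.val_cast_of_lt hb] using congrArg ZMod.val h

lemma chord_inj {n : ℕ} {x y : ℕ × ℕ} (hx : x.1 < x.2) (hx' : x.2 < n)
    (hy : y.1 < y.2) (hy' : y.2 < n) : chord n x = chord n y ↔ x = y := by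
  refine ⟨fun h => ?_, fun h => h ▸ rfl⟩
  rw [chord, chord, Sym2.eq_iff, natCast_inj (by omega) (by omega),
    natCast_inj (by omega) (by omega), natCast_inj (by omega) (by omega),
    natCast_inj (by omega) (by omega)] at h
  exact Prod.ext (by omega) (by omega)

lemma exists_chord_eq {n : ℕ} (hn : 0 < n) {v w : ZMod n} (h : v ≠ w) :
    ∃ a b, a < b ∧ b < n ∧ s(v, w) = chord n (a, b) := by
  obtain ⟨a, ha, rfl⟩ := exists_natCast_eq hn v
  obtain ⟨b, hb, rfl⟩ := exists_natCast_eq hn w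
  rcases lt_trichotomy a b with hab | rfl | hab
  · exact ⟨a, b, hab, hb, rfl⟩
  · exact absurd rfl h
  · exact ⟨b, a, hab, ha, Sym2.eq_swap⟩

lemma isEdge_chord {n a b : ℕ} (hab : a < b) (hb : b < n) : IsEdge n (chord n (a, b)) :=
  ⟨a, b, rfl, fun h => hab.ne ((natCast_inj (by omega) hb).1 h)⟩

lemma cross_chord_iff {n a b c d : ℕ} (hab : a < b) (hb : b < n) (hcd : c < d) (hd : d < n) :
    Cross n (chord n (a, b)) (chord n (c, d)) ↔
      (a < c ∧ c < b ∧ b < d) ∨ (c < a ∧ a < d ∧ d < b) := by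
  have ha : a < n := by omega
  have hc : c < n := by omega
  constructor
  · rintro ⟨v, w, y, z, h₁, h₂, h₃⟩
    rcases Sym2.eq_iff.1 h₁ with ⟨rfl, rfl⟩ | ⟨rfl, rfl⟩ <;>
    rcases Sym2.eq_iff.1 h₂ with ⟨rfl, rfl⟩ | ⟨rfl, rfl⟩ <;>
    simp only [val_natCast_sub, ha, hb, hc, hd] at h₃ <;>
    split_ifs at h₃ <;> omega
  · rintro (h | h)
    · refine ⟨a, b, c, d, rfl, rfl, ?_⟩
      simp only [val_natCast_sub, ha, hb, hc, hd]
      split_ifs <;> omega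
    · refine ⟨b, a, c, d, Sym2.eq_swap, rfl, ?_⟩
      simp only [val_natCast_sub, ha, hb, hc, hd]
      split_ifs <;> omega

lemma isDiagonal_chord_iff {n a b : ℕ} (hab : a < b) (hb : b < n) :
    IsDiagonal n (chord n (a, b)) ↔ a + 2 ≤ b ∧ b + 2 ≤ n + a := by
  have ha : a < n := by omega
  constructor
  · rintro ⟨v, w, h₁, -, ⟨c, hc⟩, ⟨d, hd⟩⟩
    simp only [Btw] at hc hd
    have h₂ : 1 < (w - v).val := by omega
    have h₃ : 1 < (v - w).val := by omega
    rcases Sym2.eq_iff.1 h₁ with ⟨rfl, rfl⟩ | ⟨rfl, rfl⟩ <;>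
    simp only [val_natCast_sub, ha, hb] at h₂ h₃ <;>
    split_ifs at h₂ h₃ <;> omega
  · rintro ⟨h₁, h₂⟩
    refine ⟨a, b, rfl, fun h => hab.ne ((natCast_inj ha hb).1 h), ⟨(a + 1 : ℕ), ?_⟩, ?_⟩
    · simp only [Btw, val_natCast_sub, ha, hb, show a + 1 < n by omega]
      split_ifs <;> omega
    · by_cases h : b + 1 < n
      · refine ⟨(b + 1 : ℕ), ?_⟩
        simp only [Btw, val_natCast_sub, ha, hb, h]
        split_ifs <;> omega
      · refine ⟨(0 : ℕ), ?_⟩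
        simp only [Btw, val_natCast_sub, ha, hb, show 0 < n by omega]
        split_ifs <;> omega

/-! ### Triangles of a triangulation -/

/-- The pair `(a, b)` is a diagonal of `T` or a side of the polygon. -/
def EdgeOf (n : ℕ) (T : Finset (Sym2 (ZMod n))) (a b : ℕ) : Prop :=
  chord n (a, b) ∈ T ∨ b = a + 1 ∨ n + a = b + 1

section Triangle

variable {n : ℕ} {T : Finset (Sym2 (ZMod n))}

lemma EdgeOf.not_crossing (hT : IsTriangulation n T) {a b c d : ℕ}
    (hab : a < b) (hb : b < n) (hcd : c < d) (hd : d < n)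
    (h₁ : EdgeOf n T a b) (h₂ : EdgeOf n T c d) : ¬ (a < c ∧ c < b ∧ b < d) := by
  intro h
  rcases h₁ with h₁ | h₁ | h₁ <;> rcases h₂ with h₂ | h₂ | h₂ <;> try omega
  exact hT.2.1 _ h₁ _ h₂ ((cross_chord_iff hab hb hcd hd).2 (Or.inl h))

lemma EdgeOf.or_crossing (hT : IsTriangulation n T) {a b : ℕ} (hab : a < b) (hb : b < n) :
    EdgeOf n T a b ∨ ∃ c d, c < d ∧ d < n ∧ EdgeOf n T c d ∧
      ((a < c ∧ c < b ∧ b < d) ∨ (c < a ∧ a < d ∧ d < b)) := by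
  by_cases hm : EdgeOf n T a b
  · exact Or.inl hm
  right
  have hdiag : IsDiagonal n (chord n (a, b)) := by
    rw [isDiagonal_chord_iff hab hb]
    simp only [EdgeOf, not_or] at hm
    omega
  obtain ⟨f, hf, hcr⟩ := hT.2.2 _ hdiag fun h => hm (Or.inl h)
  obtain ⟨v, w, rfl, hvw, -⟩ := hT.1 f hf
  obtain ⟨c, d, hcd, hd, hf'⟩ := exists_chord_eq (by omega) hvw
  rw [hf'] at hf hcr
  exact ⟨c, d, hcd, hd, Or.inl hf, (cross_chord_iff hab hb hcd hd).1 hcr⟩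

lemma EdgeOf.exists_triangle (hT : IsTriangulation n T) {i j : ℕ} (hij : i + 2 ≤ j)
    (hj : j < n) (h : EdgeOf n T i j) :
    ∃ k, i < k ∧ k < j ∧ EdgeOf n T i k ∧ EdgeOf n T k j := by
  classical
  have hne : ((Finset.Ioo i j).filter (EdgeOf n T i)).Nonempty :=
    ⟨i + 1, by simp only [Finset.mem_filter, Finset.mem_Ioo]
               exact ⟨by omega, Or.inr (Or.inl rfl)⟩⟩
  obtain ⟨k, hk, hmax⟩ := Finset.exists_max_image _ id hne
  simp only [Finset.mem_filter, Finset.mem_Ioo, id] at hk hmax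
  obtain ⟨⟨hik, hkj⟩, hek⟩ := hk
  refine ⟨k, hik, hkj, hek, ?_⟩
  rcases EdgeOf.or_crossing hT hkj hj with h' | ⟨c, d, hcd, hd, hm, hc | hc⟩
  · exact h'
  · exact absurd ⟨by omega, by omega, by omega⟩
      (EdgeOf.not_crossing hT (by omega) hj hcd hd h hm)
  · rcases lt_trichotomy c i with hci | rfl | hci
    · exact absurd ⟨by omega, by omega, by omega⟩
        (EdgeOf.not_crossing hT hcd hd (by omega) hj hm h)
    · have := hmax d ⟨⟨by omega, by omega⟩, hm⟩
      omega
    · exact absurd ⟨by omega, by omega, by omega⟩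
        (EdgeOf.not_crossing hT hik (by omega) hcd hd hek hm)

end Triangle

/-! ### Triangulations from binary trees -/

/-- Binary trees; one with `w` leaves encodes a triangulation of a `(w + 1)`-gon. -/
inductive PlaneTree : Type
  | leaf : PlaneTree
  | node : PlaneTree → PlaneTree → PlaneTree

namespace PlaneTree

/-- The number of leaves. -/
def width : PlaneTree → ℕ
  | leaf => 1
  | node l r => l.width + r.width

/-- The sides and diagonals of the triangulation encoded by a tree, on the vertices
`i, i + 1, …, i + width`. -/
def chords : PlaneTree → ℕ → Finset (ℕ × ℕ)
  | leaf, i => {(i, i + 1)}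
  | node l r, i => insert (i, i + (l.width + r.width)) (l.chords i ∪ r.chords (i + l.width))

lemma width_pos : ∀ t : PlaneTree, 0 < t.width
  | leaf => Nat.one_pos
  | node l _ => Nat.add_pos_left l.width_pos _

lemma exists_width_eq : ∀ w : ℕ, 0 < w → ∃ t : PlaneTree, t.width = w
  | 1, _ => ⟨leaf, rfl⟩
  | w + 2, _ => by
    obtain ⟨t, ht⟩ := exists_width_eq (w + 1) (by omega)
    exact ⟨node t leaf, by simp only [width, ht]⟩

lemma root_mem_chords (t : PlaneTree) (i : ℕ) : (i, i + t.width) ∈ t.chords i := by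
  cases t <;> simp [chords, width]

lemma bounds_of_mem_chords (t : PlaneTree) : ∀ {i a b : ℕ}, (a, b) ∈ t.chords i →
    i ≤ a ∧ a < b ∧ b ≤ i + t.width := by
  induction t with
  | leaf =>
    intro i a b h
    simp only [chords, Finset.mem_singleton, Prod.mk.injEq] at h
    simp only [width]
    omega
  | node l r hl hr =>
    intro i a b h
    have := l.width_pos
    simp only [chords, Finset.mem_insert, Finset.mem_union, Prod.mk.injEq] at h
    simp only [width]
    rcases h with h | h | h
    · omega
    · have := hl h
      omega
    · have := hr h
      omega

lemma not_crossing_of_mem_chords (t : PlaneTree) : ∀ {i a b c d : ℕ},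
    (a, b) ∈ t.chords i → (c, d) ∈ t.chords i → ¬ (a < c ∧ c < b ∧ b < d) := by
  induction t with
  | leaf =>
    intro i a b c d h h'
    simp only [chords, Finset.mem_singleton, Prod.mk.injEq] at h h'
    omega
  | node l r hl hr =>
    intro i a b c d h h'
    have bd₁ := bounds_of_mem_chords _ h
    have bd₂ := bounds_of_mem_chords _ h'
    simp only [width] at bd₁ bd₂
    simp only [chords, Finset.mem_insert, Finset.mem_union, Prod.mk.injEq] at h h'
    rcases h with h | h | h
    · omega
    · have b₁ := bounds_of_mem_chords _ h
      rcases h' with h' | h' | h'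
      · omega
      · exact hl h h'
      · have b₂ := bounds_of_mem_chords _ h'
        omega
    · have b₁ := bounds_of_mem_chords _ h
      rcases h' with h' | h' | h'
      · omega
      · have b₂ := bounds_of_mem_chords _ h'
        omega
      · exact hr h h'

lemma mem_chords_or_crossing (t : PlaneTree) : ∀ {i a b : ℕ}, i ≤ a → a < b →
    b ≤ i + t.width → (a, b) ∈ t.chords i ∨ ∃ c d, (c, d) ∈ t.chords i ∧
      ((a < c ∧ c < b ∧ b < d) ∨ (c < a ∧ a < d ∧ d < b)) := by
  induction t with
  | leaf =>
    intro i a b h₁ h₂ h₃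
    simp only [width] at h₃
    left
    simp only [chords, Finset.mem_singleton, Prod.mk.injEq]
    omega
  | node l r hl hr =>
    intro i a b h₁ h₂ h₃
    have subl : ∀ x ∈ l.chords i, x ∈ (node l r).chords i := fun x hx =>
      Finset.mem_insert_of_mem (Finset.mem_union_left _ hx)
    have subr : ∀ x ∈ r.chords (i + l.width), x ∈ (node l r).chords i := fun x hx =>
      Finset.mem_insert_of_mem (Finset.mem_union_right _ hx)
    simp only [width] at h₃
    by_cases hb : b ≤ i + l.width
    · rcases hl h₁ h₂ hb with h | ⟨c, d, h, h'⟩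
      · exact Or.inl (subl _ h)
      · exact Or.inr ⟨c, d, subl _ h, h'⟩
    by_cases ha : i + l.width ≤ a
    · rcases hr ha h₂ (by omega) with h | ⟨c, d, h, h'⟩
      · exact Or.inl (subr _ h)
      · exact Or.inr ⟨c, d, subr _ h, h'⟩
    by_cases hi : i < a
    · exact Or.inr ⟨i, i + l.width, subl _ (l.root_mem_chords i), Or.inr (by omega)⟩
    by_cases hj : b < i + l.width + r.width
    · exact Or.inr ⟨i + l.width, i + l.width + r.width, subr _ (r.root_mem_chords _),
        Or.inl (by omega)⟩
    · left
      simp only [chords, Finset.mem_insert, Prod.mk.injEq]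
      left
      omega

/-- Substituting trees for the leaves of `t`: the triangulation encoded by `t` is realised on
the vertices `ρ p, ρ (p + 1), …`, and the gaps between these are triangulated arbitrarily. -/
lemma exists_refinement (t : PlaneTree) (ρ : ℕ → ℕ) : ∀ p : ℕ,
    (∀ u, p ≤ u → u < p + t.width → ρ u < ρ (u + 1)) →
    ∃ t' : PlaneTree, ρ p + t'.width = ρ (p + t.width) ∧
      ∀ a b, (a, b) ∈ t'.chords (ρ p) →
        (∃ u v, (u, v) ∈ t.chords p ∧ a = ρ u ∧ b = ρ v) ∨
        ∃ u, p ≤ u ∧ u < p + t.width ∧ ρ u ≤ a ∧ b ≤ ρ (u + 1) := by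
  induction t with
  | leaf =>
    intro p h
    have hp := h p le_rfl (by simp [width])
    obtain ⟨t', ht'⟩ := exists_width_eq (ρ (p + 1) - ρ p) (by omega)
    refine ⟨t', by simp only [width]; omega, fun a b hab => Or.inr ⟨p, le_rfl, ?_⟩⟩
    have := bounds_of_mem_chords _ hab
    simp only [width]
    omega
  | node l r hl hr =>
    intro p h
    simp only [width] at h
    obtain ⟨l', hl₁, hl₂⟩ := hl p fun u h₁ h₂ => h u h₁ (by omega)
    obtain ⟨r', hr₁, hr₂⟩ := hr (p + l.width) fun u h₁ h₂ => h u (by omega) (by omega)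
    refine ⟨node l' r', by simp only [width, ← add_assoc]; omega, fun a b hab => ?_⟩
    simp only [chords, Finset.mem_insert, Finset.mem_union, Prod.mk.injEq, width] at hab ⊢
    rcases hab with hab | hab | hab
    · refine Or.inl ⟨p, p + (l.width + r.width), Or.inl ⟨rfl, rfl⟩, hab.1, ?_⟩
      rw [← add_assoc, ← hr₁]
      omega
    · rcases hl₂ a b hab with ⟨u, v, h₁, h₂⟩ | ⟨u, h₁, h₂, h₃⟩
      · exact Or.inl ⟨u, v, Or.inr (Or.inl h₁), h₂⟩
      · exact Or.inr ⟨u, h₁, by omega, h₃⟩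
    · rw [hl₁] at hab
      rcases hr₂ a b hab with ⟨u, v, h₁, h₂⟩ | ⟨u, h₁, h₂, h₃⟩
      · exact Or.inl ⟨u, v, Or.inr (Or.inr h₁), h₂⟩
      · exact Or.inr ⟨u, by omega, by omega, h₃⟩

/-- The diagonals of the `n`-gon among the chords of a tree. -/
def diagonals (n : ℕ) (t : PlaneTree) : Finset (Sym2 (ZMod n)) :=
  ((t.chords 0).filter fun x => x.1 + 2 ≤ x.2 ∧ x.2 + 2 ≤ n + x.1).image (chord n)

lemma isTriangulation_diagonals {n : ℕ} {t : PlaneTree} (ht : t.width + 1 = n) :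
    IsTriangulation n (t.diagonals n) := by
  have key : ∀ e ∈ t.diagonals n, ∃ a b, e = chord n (a, b) ∧ a < b ∧ b < n ∧
      (a, b) ∈ t.chords 0 ∧ a + 2 ≤ b ∧ b + 2 ≤ n + a := by
    intro e he
    simp only [diagonals, Finset.mem_image, Finset.mem_filter, Prod.exists] at he
    obtain ⟨a, b, ⟨hab, h⟩, rfl⟩ := he
    have := bounds_of_mem_chords _ hab
    exact ⟨a, b, rfl, by omega, by omega, hab, h⟩
  refine ⟨fun e he => ?_, fun e he f hf hc => ?_, fun e he hne => ?_⟩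
  · obtain ⟨a, b, rfl, hab, hb, -, h⟩ := key e he
    exact (isDiagonal_chord_iff hab hb).2 h
  · obtain ⟨a, b, rfl, hab, hb, h, -⟩ := key e he
    obtain ⟨c, d, rfl, hcd, hd, h', -⟩ := key f hf
    rcases (cross_chord_iff hab hb hcd hd).1 hc with hc | hc
    · exact not_crossing_of_mem_chords t h h' hc
    · exact not_crossing_of_mem_chords t h' h hc
  · obtain ⟨v, w, rfl, hvw, -⟩ := id he
    obtain ⟨a, b, hab, hb, hab'⟩ := exists_chord_eq (by omega) hvw
    rw [hab'] at he hne ⊢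
    rw [isDiagonal_chord_iff hab hb] at he
    rcases mem_chords_or_crossing t (Nat.zero_le a) hab (by omega) with h | ⟨c, d, h, hcr⟩
    · refine absurd (Finset.mem_image_of_mem _ ?_) hne
      exact Finset.mem_filter.2 ⟨h, he⟩
    · have := bounds_of_mem_chords _ h
      refine ⟨chord n (c, d), Finset.mem_image_of_mem _ (Finset.mem_filter.2 ⟨h, ?_⟩),
        (cross_chord_iff hab hb (by omega) (by omega)).2 hcr⟩
      simp only
      omega

end PlaneTree

/-! ### Blow-ups -/

/-- The pairs `a < b` of vertices whose classes under `φ` form a pair of `P`. -/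
def blowupPairs (n : ℕ) (P : Finset (ℕ × ℕ)) (φ : ℕ → ℕ) : Finset (ℕ × ℕ) :=
  (Finset.range n ×ˢ Finset.range n).filter fun x => x.1 < x.2 ∧ (φ x.1, φ x.2) ∈ P

/-- The set of edges of the `n`-gon obtained by replacing each vertex of the pattern `P` by its
class under `φ`. -/
def blowup (n : ℕ) (P : Finset (ℕ × ℕ)) (φ : ℕ → ℕ) : Finset (Sym2 (ZMod n)) :=
  (blowupPairs n P φ).image (chord n)

lemma mem_blowupPairs {n : ℕ} {P : Finset (ℕ × ℕ)} {φ : ℕ → ℕ} {a b : ℕ} :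
    (a, b) ∈ blowupPairs n P φ ↔ a < b ∧ b < n ∧ (φ a, φ b) ∈ P := by
  simp only [blowupPairs, Finset.mem_filter, Finset.mem_product, Finset.mem_range]
  constructor
  · rintro ⟨⟨-, h₁⟩, h₂, h₃⟩
    exact ⟨h₂, h₁, h₃⟩
  · rintro ⟨h₁, h₂, h₃⟩
    exact ⟨⟨h₁.trans h₂, h₂⟩, h₁, h₃⟩

lemma card_blowup (n : ℕ) (P : Finset (ℕ × ℕ)) (φ : ℕ → ℕ) :
    (blowup n P φ).card = (blowupPairs n P φ).card := by
  refine Finset.card_image_of_injOn ?_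
  rintro ⟨a, b⟩ h ⟨c, d⟩ h' heq
  rw [Finset.mem_coe, mem_blowupPairs] at h h'
  exact (chord_inj h.1 h.2.1 h'.1 h'.2.1).1 heq

/-- The size of a blow-up is the sum over the pattern of products of class sizes. -/
lemma card_blowupPairs {n : ℕ} {P : Finset (ℕ × ℕ)} {φ : ℕ → ℕ} (hφ : Monotone φ)
    (hP : ∀ x ∈ P, x.1 < x.2) :
    (blowupPairs n P φ).card = ∑ x ∈ P, ((Finset.range n).filter fun a => φ a = x.1).card *
      ((Finset.range n).filter fun a => φ a = x.2).card := by
  rw [Finset.card_eq_sum_card_fiberwise (f := fun x => (φ x.1, φ x.2)) (t := P)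
    (by rintro ⟨a, b⟩ h; exact (mem_blowupPairs.1 h).2.2)]
  refine Finset.sum_congr rfl ?_
  rintro ⟨p, q⟩ hpq
  rw [← Finset.card_product]
  congr 1
  ext ⟨a, b⟩
  simp only [Finset.mem_filter, Finset.mem_product, Finset.mem_range, mem_blowupPairs,
    Prod.mk.injEq]
  constructor
  · rintro ⟨⟨h₁, h₂, -⟩, h₃, h₄⟩
    exact ⟨⟨by omega, h₃⟩, h₂, h₄⟩
  · rintro ⟨⟨-, rfl⟩, h₂, rfl⟩
    refine ⟨⟨?_, h₂, hpq⟩, rfl, rfl⟩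
    by_contra h
    exact absurd (hφ (not_lt.1 h)) (not_le.2 (hP _ hpq))

/-- If no triangulation avoids the pattern `P`, as witnessed by the set `O` of pairs of classes
between which every triangulation meets `P`, then the blow-up of `P` is a blocker. -/
lemma isBlocker_blowup {n m : ℕ} {P O : Finset (ℕ × ℕ)} {φ : ℕ → ℕ} (hn : 0 < n)
    (hP : ∀ x ∈ P, x.1 + 2 ≤ x.2) (hP' : (0, m) ∉ P) (hroot : (0, m) ∈ O)
    (hO : ∀ x ∈ O, x.1 + 2 ≤ x.2)
    (hOP : ∀ x ∈ O, ∀ r ∈ Finset.Ioo x.1 x.2, (x.1, r) ∈ O ∪ P ∨ (r, x.2) ∈ O ∪ P)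
    (hφ : Monotone φ) (hstep : ∀ a, φ (a + 1) ≤ φ a + 1) (h0 : φ 0 = 0) (hm : φ (n - 1) = m) :
    IsBlocker n (blowup n P φ) := by
  constructor
  · intro e he
    obtain ⟨⟨a, b⟩, hx, rfl⟩ := Finset.mem_image.1 he
    rw [mem_blowupPairs] at hx
    exact isEdge_chord hx.1 hx.2.1
  intro T hT
  by_contra hdisj
  have hav : ∀ a b, a < b → b < n → EdgeOf n T a b → (φ a, φ b) ∉ P := by
    intro a b hab hb h hmem
    rcases h with h | rfl | h
    · refine hdisj ⟨chord n (a, b), Finset.mem_inter.2 ⟨?_, h⟩⟩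
      exact Finset.mem_image_of_mem _ (mem_blowupPairs.2 ⟨hab, hb, hmem⟩)
    · have := hP _ hmem
      have := hstep a
      simp only at *
      omega
    · obtain rfl : a = 0 := by omega
      obtain rfl : b = n - 1 := by omega
      rw [h0, hm] at hmem
      exact hP' hmem
  have hO' : ∀ k a b, b ≤ a + k → a < b → b < n → EdgeOf n T a b → (φ a, φ b) ∉ O := by
    intro k
    induction k with
    | zero => intros; omega
    | succ k ih =>
      intro a b hk hab hb he hmem
      have hlen : a + 2 ≤ b := by
        by_contra hlt
        obtain rfl : b = a + 1 := by omega
        have := hO _ hmem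
        have := hstep a
        simp only at *
        omega
      obtain ⟨c, hac, hcb, h₁, h₂⟩ := he.exists_triangle hT hlen hb
      have n₁ := ih a c (by omega) hac (by omega) h₁
      have n₂ := ih c b (by omega) hcb hb h₂
      have m₁ := hav a c hac (by omega) h₁
      have m₂ := hav c b hcb hb h₂
      rcases (hφ hac.le).eq_or_lt with hx | hx
      · exact n₂ (hx ▸ hmem)
      rcases (hφ hcb.le).eq_or_lt with hy | hy
      · exact n₁ (hy ▸ hmem)
      rcases hOP _ hmem (φ c) (Finset.mem_Ioo.2 ⟨hx, hy⟩) with h | h <;>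
      rcases Finset.mem_union.1 h with h | h <;> contradiction
  have hn1 : 0 < n - 1 := by
    rcases Nat.eq_zero_or_pos (n - 1) with h | h
    · have := hO _ hroot
      rw [h, h0] at hm
      simp only at this
      omega
    · exact h
  refine hO' n 0 (n - 1) (by omega) hn1 (by omega) (Or.inr (Or.inr (by omega))) ?_
  rwa [h0, hm]

/-- If for every pair `x` of the pattern `P` some triangulation meets `P` at most in `x`, then
no edge of the blow-up of `P` is superfluous. -/
lemma not_isBlocker_erase_blowup {n m : ℕ} {P : Finset (ℕ × ℕ)} {φ : ℕ → ℕ}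
    (hP : ∀ x ∈ P, x.1 + 2 ≤ x.2)
    (hsat : ∀ x ∈ P, ∃ t : PlaneTree, t.width = m ∧ ∀ y ∈ t.chords 0, y ∈ P → y = x)
    (hφ : Monotone φ) (hsurj : ∀ p ≤ m, ∃ a < n, φ a = p)
    (h0 : ∀ a < n, φ a = 0 → a = 0) (hm : ∀ a < n, φ a = m → a + 1 = n)
    {e : Sym2 (ZMod n)} (he : e ∈ blowup n P φ) : ¬ IsBlocker n ((blowup n P φ).erase e) := by
  obtain ⟨⟨x, y⟩, hxy, rfl⟩ := Finset.mem_image.1 he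
  rw [mem_blowupPairs] at hxy
  obtain ⟨hlt, hy, hmem⟩ := hxy
  obtain ⟨t, htw, ht⟩ := hsat _ hmem
  have hrep : ∀ p, ∃ a, p ≤ m → a < n ∧ φ a = p ∧ (p = φ x → a = x) ∧ (p = φ y → a = y) := by
    intro p
    have hne := hP _ hmem
    simp only at hne
    rcases eq_or_ne p (φ x) with rfl | h₁
    · exact ⟨x, fun _ => ⟨by omega, rfl, fun _ => rfl, fun h => by omega⟩⟩
    rcases eq_or_ne p (φ y) with rfl | h₂
    · exact ⟨y, fun _ => ⟨hy, rfl, fun h => absurd h h₁, fun _ => rfl⟩⟩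
    by_cases hp : p ≤ m
    · obtain ⟨a, ha, hap⟩ := hsurj p hp
      exact ⟨a, fun _ => ⟨ha, hap, fun h => absurd h h₁, fun h => absurd h h₂⟩⟩
    · exact ⟨0, fun h => absurd h hp⟩
  choose ρ hρ using hrep
  have hρ0 : ρ 0 = 0 := h0 _ (hρ 0 (Nat.zero_le m)).1 (hρ 0 (Nat.zero_le m)).2.1
  have hρm : ρ m + 1 = n := hm _ (hρ m le_rfl).1 (hρ m le_rfl).2.1
  have hmono : ∀ u, 0 ≤ u → u < 0 + t.width → ρ u < ρ (u + 1) := by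
    intro u _ hu
    by_contra h
    have := hφ (not_lt.1 h)
    rw [(hρ u (by omega)).2.1, (hρ (u + 1) (by omega)).2.1] at this
    omega
  obtain ⟨t', ht'w, ht'⟩ := t.exists_refinement ρ 0 hmono
  rw [zero_add, htw, hρ0, zero_add] at ht'w
  intro hB
  obtain ⟨f, hf⟩ := hB.2 _ (PlaneTree.isTriangulation_diagonals (t := t') (by omega))
  obtain ⟨⟨hfne, hfB⟩, hfT⟩ := by
    simpa only [Finset.mem_inter, Finset.mem_erase] using hf
  obtain ⟨⟨c, d⟩, hcd, rfl⟩ := Finset.mem_image.1 hfT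
  obtain ⟨hcd, -⟩ := Finset.mem_filter.1 hcd
  have hbd := t'.bounds_of_mem_chords hcd
  obtain ⟨⟨c', d'⟩, hcd', heq⟩ := Finset.mem_image.1 hfB
  rw [mem_blowupPairs] at hcd'
  rw [chord_inj hcd'.1 hcd'.2.1 hbd.2.1 (by simp only; omega), Prod.mk.injEq] at heq
  obtain ⟨rfl, rfl⟩ := heq
  obtain ⟨-, hd, hcdP⟩ := hcd'
  rcases ht' c' d' (by rwa [hρ0]) with ⟨u, v, huv, rfl, rfl⟩ | ⟨u, -, hu, h₁, h₂⟩
  · have hb := t.bounds_of_mem_chords huv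
    have hu := hρ u (by omega)
    have hv := hρ v (by omega)
    rw [hu.2.1, hv.2.1] at hcdP
    have := ht _ huv hcdP
    rw [Prod.mk.injEq] at this
    exact hfne (by rw [hu.2.2.1 this.1, hv.2.2.2 this.2])
  · have hc := hφ h₁
    have hd := hφ h₂
    rw [(hρ u (by omega)).2.1] at hc
    rw [(hρ (u + 1) (by omega)).2.1] at hd
    have := hP _ hcdP
    simp only at this
    omega

/-! ### A saturated blocker of the decagon and its blow-ups -/

/-- A saturated blocker of the decagon. -/
def decagonPattern : Finset (ℕ × ℕ) :=
  {(0, 8), (1, 3), (2, 4), (2, 5), (2, 6), (2, 7), (2, 8), (3, 9), (4, 6), (5, 7), (6, 8), (7, 9)}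

/-- The pairs `(p, q)` such that every triangulation of the polygon `p, p + 1, …, q` meets
`decagonPattern` in a diagonal other than `(p, q)`. -/
def decagonObstruction : Finset (ℕ × ℕ) :=
  {(0, 9), (1, 4), (1, 5), (1, 6), (1, 7), (1, 8), (1, 9), (2, 9), (4, 7), (4, 8), (4, 9), (5, 8),
    (5, 9), (6, 9)}

open PlaneTree in
lemma decagonPattern_saturated : ∀ x ∈ decagonPattern, ∃ t : PlaneTree, t.width = 9 ∧
    ∀ y ∈ t.chords 0, y ∈ decagonPattern → y = x := by
  simp only [decagonPattern, Finset.forall_mem_insert, Finset.mem_singleton, forall_eq]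
  refine ⟨?_, ?_, ?_, ?_, ?_, ?_, ?_, ?_, ?_, ?_, ?_, ?_⟩
  · exact ⟨.node (.node (.node (.node .leaf .leaf) .leaf) (.node (.node (.node (.node
      .leaf .leaf) .leaf) .leaf) .leaf)) .leaf,
      by decide, by decide⟩
  · exact ⟨.node .leaf (.node (.node (.node .leaf .leaf) (.node (.node (.node (.node
      .leaf .leaf) .leaf) .leaf) .leaf)) .leaf),
      by decide, by decide⟩
  · exact ⟨.node .leaf (.node (.node (.node (.node (.node (.node .leaf (.node .leaf
      .leaf)) .leaf) .leaf) .leaf) .leaf) .leaf),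
      by decide, by decide⟩
  · exact ⟨.node .leaf (.node (.node (.node (.node (.node .leaf (.node .leaf (.node .leaf
      .leaf))) .leaf) .leaf) .leaf) .leaf),
      by decide, by decide⟩
  · exact ⟨.node .leaf (.node (.node (.node (.node .leaf (.node .leaf (.node (.node .leaf
      .leaf) .leaf))) .leaf) .leaf) .leaf),
      by decide, by decide⟩
  · exact ⟨.node .leaf (.node (.node (.node .leaf (.node .leaf (.node (.node (.node .leaf
      .leaf) .leaf) .leaf))) .leaf) .leaf),
      by decide, by decide⟩
  · exact ⟨.node .leaf (.node .leaf (.node (.node .leaf (.node (.node (.node (.node .leaf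
      .leaf) .leaf) .leaf) .leaf)) .leaf)),
      by decide, by decide⟩
  · exact ⟨.node .leaf (.node .leaf (.node .leaf (.node (.node (.node (.node (.node .leaf
      .leaf) .leaf) .leaf) .leaf) .leaf))),
      by decide, by decide⟩
  · exact ⟨.node (.node (.node (.node .leaf .leaf) .leaf) .leaf) (.node (.node (.node
      (.node .leaf .leaf) .leaf) .leaf) .leaf),
      by decide, by decide⟩
  · exact ⟨.node (.node (.node (.node .leaf .leaf) .leaf) .leaf) (.node .leaf (.node (.node
      (.node .leaf .leaf) .leaf) .leaf)),
      by decide, by decide⟩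
  · exact ⟨.node (.node (.node (.node .leaf .leaf) .leaf) .leaf) (.node .leaf (.node .leaf
      (.node (.node .leaf .leaf) .leaf))),
      by decide, by decide⟩
  · exact ⟨.node (.node (.node (.node .leaf .leaf) .leaf) .leaf) (.node .leaf (.node .leaf
      (.node .leaf (.node .leaf .leaf)))),
      by decide, by decide⟩

/-- The classes of the blow-up of the decagon in which the vertices `2, 4, 6, 8` are replaced by
`x, y, z` and `w` vertices. -/
def decagonClass (x y z w a : ℕ) : ℕ :=
  if a < 1 then 0 else if a < 2 then 1 else if a < x + 2 then 2 else if a < x + 3 then 3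
  else if a < x + y + 3 then 4 else if a < x + y + 4 then 5 else if a < x + y + z + 4 then 6
  else if a < x + y + z + 5 then 7 else if a < x + y + z + w + 5 then 8 else 9

lemma decagonClass_spec (x y z w a : ℕ) :
    (1 ≤ decagonClass x y z w a ↔ 1 ≤ a) ∧ (2 ≤ decagonClass x y z w a ↔ 2 ≤ a) ∧
    (3 ≤ decagonClass x y z w a ↔ x + 2 ≤ a) ∧ (4 ≤ decagonClass x y z w a ↔ x + 3 ≤ a) ∧
    (5 ≤ decagonClass x y z w a ↔ x + y + 3 ≤ a) ∧ (6 ≤ decagonClass x y z w a ↔ x + y + 4 ≤ a) ∧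
    (7 ≤ decagonClass x y z w a ↔ x + y + z + 4 ≤ a) ∧
    (8 ≤ decagonClass x y z w a ↔ x + y + z + 5 ≤ a) ∧
    (9 ≤ decagonClass x y z w a ↔ x + y + z + w + 5 ≤ a) ∧ decagonClass x y z w a ≤ 9 := by
  simp only [decagonClass]
  split_ifs <;> omega

lemma monotone_decagonClass (x y z w : ℕ) : Monotone (decagonClass x y z w) := by
  intro a b h
  have ha := decagonClass_spec x y z w a
  have hb := decagonClass_spec x y z w b
  generalize decagonClass x y z w a = p at *
  have hp : p ≤ 9 := by omega
  interval_cases p <;> omega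

lemma isSaturatedBlocker_decagon {n x y z w : ℕ} (hx : 0 < x) (hy : 0 < y) (hz : 0 < z)
    (hw : 0 < w) (hn : n = x + y + z + w + 6) :
    IsSaturatedBlocker n (blowup n decagonPattern (decagonClass x y z w)) := by
  subst hn
  refine ⟨isBlocker_blowup (m := 9) (O := decagonObstruction) (by omega) (by decide) (by decide)
    (by decide) (by decide) (by decide) (monotone_decagonClass x y z w) ?_ ?_ ?_,
    fun e he => not_isBlocker_erase_blowup (m := 9) (by decide)
      decagonPattern_saturated (monotone_decagonClass x y z w) ?_ ?_ ?_ he⟩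
  · intro a
    have ha := decagonClass_spec x y z w a
    have hb := decagonClass_spec x y z w (a + 1)
    generalize decagonClass x y z w a = p at *
    have hp : p ≤ 9 := by omega
    interval_cases p <;> omega
  · rfl
  · have := decagonClass_spec x y z w (x + y + z + w + 6 - 1)
    omega
  · intro p hp
    have key : ∀ a, a < x + y + z + w + 6 → decagonClass x y z w a = p →
      ∃ a < x + y + z + w + 6, decagonClass x y z w a = p := fun a h h' => ⟨a, h, h'⟩
    interval_cases p
    · exact key 0 (by omega) rfl
    · exact key 1 (by omega) rfl
    · exact key 2 (by omega) (by have := decagonClass_spec x y z w 2; omega)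
    · exact key (x + 2) (by omega) (by have := decagonClass_spec x y z w (x + 2); omega)
    · exact key (x + 3) (by omega) (by have := decagonClass_spec x y z w (x + 3); omega)
    · exact key (x + y + 3) (by omega) (by have := decagonClass_spec x y z w (x + y + 3); omega)
    · exact key (x + y + 4) (by omega) (by have := decagonClass_spec x y z w (x + y + 4); omega)
    · exact key (x + y + z + 4) (by omega) (by have := decagonClass_spec x y z w (x + y + z + 4); omega)
    · exact key (x + y + z + 5) (by omega) (by have := decagonClass_spec x y z w (x + y + z + 5); omega)
    · exact key (x + y + z + w + 5) (by omega) (by have := decagonClass_spec x y z w (x + y + z + w + 5); omega)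
  · intro a ha
    have := decagonClass_spec x y z w a
    omega
  · intro a ha
    have := decagonClass_spec x y z w a
    omega

lemma card_decagonClass_fiber {n x y z w p lo hi : ℕ}
    (h : ∀ a, a < n ∧ decagonClass x y z w a = p ↔ lo ≤ a ∧ a < hi) :
    ((Finset.range n).filter fun a => decagonClass x y z w a = p).card = hi - lo := by
  rw [← Nat.card_Ico]
  congr 1
  ext a
  simpa only [Finset.mem_filter, Finset.mem_range, Finset.mem_Ico] using h a

lemma card_decagon {n x y z w : ℕ} (hn : n = x + y + z + w + 6) :
    (blowup n decagonPattern (decagonClass x y z w)).card =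
      x * z + (x + z) * (y + w) + 2 * x + w + 4 := by
  subst hn
  have fiber := fun p lo hi => card_decagonClass_fiber (n := x + y + z + w + 6)
    (x := x) (y := y) (z := z) (w := w) (p := p) (lo := lo) (hi := hi)
  have f0 := fiber 0 0 1 (by intro a; have := decagonClass_spec x y z w a; omega)
  have f1 := fiber 1 1 2 (by intro a; have := decagonClass_spec x y z w a; omega)
  have f2 := fiber 2 2 (x + 2) (by intro a; have := decagonClass_spec x y z w a; omega)
  have f3 := fiber 3 (x + 2) (x + 3) (by intro a; have := decagonClass_spec x y z w a; omega)
  have f4 := fiber 4 (x + 3) (x + y + 3)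
    (by intro a; have := decagonClass_spec x y z w a; omega)
  have f5 := fiber 5 (x + y + 3) (x + y + 4)
    (by intro a; have := decagonClass_spec x y z w a; omega)
  have f6 := fiber 6 (x + y + 4) (x + y + z + 4)
    (by intro a; have := decagonClass_spec x y z w a; omega)
  have f7 := fiber 7 (x + y + z + 4) (x + y + z + 5)
    (by intro a; have := decagonClass_spec x y z w a; omega)
  have f8 := fiber 8 (x + y + z + 5) (x + y + z + w + 5)
    (by intro a; have := decagonClass_spec x y z w a; omega)
  have f9 := fiber 9 (x + y + z + w + 5) (x + y + z + w + 6)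
    (by intro a; have := decagonClass_spec x y z w a; omega)
  rw [card_blowup, card_blowupPairs (monotone_decagonClass x y z w) (by decide), decagonPattern]
  repeat rw [Finset.sum_insert (by decide)]
  rw [Finset.sum_singleton]
  simp only [f0, f1, f2, f3, f4, f5, f6, f7, f8, f9]
  rw [show x + 2 - 2 = x by omega, show x + 3 - (x + 2) = 1 by omega,
    show x + y + 3 - (x + 3) = y by omega, show x + y + 4 - (x + y + 3) = 1 by omega,
    show x + y + z + 4 - (x + y + 4) = z by omega,
    show x + y + z + 5 - (x + y + z + 4) = 1 by omega,
    show x + y + z + w + 5 - (x + y + z + 5) = w by omega,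
    show x + y + z + w + 6 - (x + y + z + w + 5) = 1 by omega]
  ring

/-- For fixed `x, z` and `y + w = s`, the sizes of the blow-ups of the decagon fill an
interval. -/
lemma exists_saturated_of_mem_interval {n x z s t : ℕ} (hx : 0 < x) (hz : 0 < z)
    (hn : n = x + z + s + 6) (h₁ : x * z + (x + z) * s + 2 * x + 4 < t)
    (h₂ : t < x * z + (x + z) * s + 2 * x + 4 + s) :
    ∃ B : Finset (Sym2 (ZMod n)), IsSaturatedBlocker n B ∧ B.card = t := by
  obtain ⟨w, hw⟩ := Nat.exists_eq_add_of_lt h₁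
  obtain ⟨y, rfl⟩ : ∃ y, s = y + (w + 1) := ⟨s - (w + 1), by omega⟩
  refine ⟨_, isSaturatedBlocker_decagon (x := x) (y := y) (z := z) (w := w + 1) hx (by omega) hz
    (by omega) (by omega), ?_⟩
  rw [card_decagon (by omega), hw]
  ring

end ConvexBlocker

open ConvexBlocker in
/-- for every `n ≥ 25` and every `t` with `8t ≥ n² + 4n - 16` and
`16t ≤ 5n² - 48n + 205`, there is a saturated blocker of the convex `n`-gon with exactly `t`
edges. -/
theorem spectrum_second_range
    (n : ℕ) (hn : 25 ≤ n) (t : ℕ)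
    (ht1 : n ^ 2 + 4 * n ≤ 8 * t + 16) (ht2 : 16 * t + 48 * n ≤ 5 * n ^ 2 + 205) :
    ∃ B : Finset (Sym2 (ZMod n)), IsSaturatedBlocker n B ∧ B.card = t := by
  obtain ⟨N, rfl⟩ : ∃ N, n = N + 6 := ⟨n - 6, by omega⟩
  -- The largest `P = x + z` for which the smallest blow-up has at most `t` edges.
  let p : ℕ → Prop := fun P => P * (N - P) + P + 6 ≤ t
  have hp2 : p 2 := by
    simp only [p]
    obtain ⟨M, rfl⟩ : ∃ M, N = M + 2 := ⟨N - 2, by omega⟩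
    rw [Nat.add_sub_cancel]
    nlinarith
  obtain ⟨P, hP2, hPN, hP, hmax⟩ : ∃ P, 2 ≤ P ∧ P ≤ N / 2 ∧ p P ∧ (P = N / 2 ∨ ¬ p (P + 1)) := by
    refine ⟨Nat.findGreatest p (N / 2), Nat.le_findGreatest (by omega) hp2,
      Nat.findGreatest_le _, Nat.findGreatest_spec (m := 2) (by omega) hp2, ?_⟩
    rcases (Nat.findGreatest_le (P := p) (N / 2)).eq_or_lt with h | h
    · exact Or.inl h
    · exact Or.inr (Nat.findGreatest_is_greatest (Nat.lt_succ_self _) h)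
  obtain ⟨s, rfl⟩ : ∃ s, N = P + s := ⟨N - P, by omega⟩
  simp only [p, Nat.add_sub_cancel_left] at hP
  rcases hmax with hmid | hmax
  · -- Balance `x` and `z`.
    let q : ℕ → Prop := fun x => x * (P - x) + P * s + 2 * x + 5 ≤ t
    have hq1 : q 1 := by
      simp only [q]
      omega
    obtain ⟨x, hx1, hxP, hx, hxmax⟩ :
        ∃ x, 1 ≤ x ∧ x ≤ (P + 1) / 2 ∧ q x ∧ (x = (P + 1) / 2 ∨ ¬ q (x + 1)) := by
      refine ⟨Nat.findGreatest q ((P + 1) / 2), Nat.le_findGreatest (by omega) hq1,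
        Nat.findGreatest_le _, Nat.findGreatest_spec (m := 1) (by omega) hq1, ?_⟩
      rcases (Nat.findGreatest_le (P := q) ((P + 1) / 2)).eq_or_lt with h | h
      · exact Or.inl h
      · exact Or.inr (Nat.findGreatest_is_greatest (Nat.lt_succ_self _) h)
    obtain ⟨z, rfl⟩ : ∃ z, P = x + z := ⟨P - x, by omega⟩
    simp only [q, Nat.add_sub_cancel_left] at hx
    refine exists_saturated_of_mem_interval (x := x) (z := z) (s := s) (by omega) (by omega)
      (by omega) (by omega) ?_
    rcases hxmax with hbal | hxmax
    · have hs : s = x + z ∨ s = x + z + 1 := by omega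
      have hxz : x = z ∨ x = z + 1 := by omega
      rcases hs with rfl | rfl <;> rcases hxz with rfl | rfl <;> nlinarith
    · have hs : x + z ≤ s := by omega
      obtain ⟨v, rfl⟩ : ∃ v, z = v + 1 := ⟨z - 1, by omega⟩
      simp only [q, show x + (v + 1) - (x + 1) = v by omega, not_le] at hxmax
      nlinarith
  · simp only [p, not_le] at hmax
    obtain ⟨r, rfl⟩ : ∃ r, s = r + 1 := ⟨s - 1, by omega⟩
    obtain ⟨z, rfl⟩ : ∃ z, P = z + 1 := ⟨P - 1, by omega⟩
    rw [show z + 1 + (r + 1) - (z + 1 + 1) = r by omega] at hmax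
    refine exists_saturated_of_mem_interval (x := 1) (z := z) (s := r + 1) (by omega) (by omega)
      (by omega) (by nlinarith) (by nlinarith)
end

section
/- There exist a real constant C > 0 and an integer n₀ such that for every integer n > n₀ and every integer t satisfying 4t ≥ n² − 8n + 40 (i.e., t ≥ n²/4 − 2n + 10) and t ≤ n²/2 − C·n·log n, there exists a saturated blocker of the convex n-gon consisting of exactly t edges. -/
open Finset

namespace ConvexBlocker

/-- The arc `a, a + 1, …, b` can be triangulated by chords allowed by `R`, the chord `(a, b)`
itself being a side or allowed. -/
inductive Fillable (R : ℕ → ℕ → Prop) : ℕ → ℕ → Prop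
  | side (a : ℕ) : Fillable R a (a + 1)
  | tri {a c b : ℕ} : R a b → Fillable R a c → Fillable R c b → Fillable R a b

namespace Fillable

variable {R R' : ℕ → ℕ → Prop}

theorem lt {a b : ℕ} (h : Fillable R a b) : a < b := by
  induction h with
  | side a => omega
  | tri _ _ _ h₁ h₂ => omega

theorem mono (hR : ∀ i j, R i j → R' i j) {a b : ℕ} (h : Fillable R a b) : Fillable R' a b := by
  induction h with
  | side a => exact side a
  | tri h _ _ h₁ h₂ => exact tri (hR _ _ h) h₁ h₂

/-- A fillable arc carries a maximal family of pairwise non-crossing allowed chords. -/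
theorem exists_maximal {a b : ℕ} (h : Fillable R a b) :
    ∃ T : Finset (ℕ × ℕ),
      (∀ p ∈ T, a ≤ p.1 ∧ p.1 + 2 ≤ p.2 ∧ p.2 ≤ b ∧ R p.1 p.2) ∧
      (∀ p ∈ T, ∀ q ∈ T, ¬ (p.1 < q.1 ∧ q.1 < p.2 ∧ p.2 < q.2)) ∧
      (a + 2 ≤ b → (a, b) ∈ T) ∧
      ∀ i j, a ≤ i → i + 2 ≤ j → j ≤ b → (i, j) ∉ T →
        ∃ p ∈ T, (p.1 < i ∧ i < p.2 ∧ p.2 < j) ∨ (i < p.1 ∧ p.1 < j ∧ j < p.2) := by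
  induction h with
  | side a => exact ⟨∅, by simp, by simp, by omega, by intros; omega⟩
  | @tri a c b hR hac hcb ih₁ ih₂ =>
    have h1 := hac.lt
    have h2 := hcb.lt
    obtain ⟨T₁, s₁, n₁, r₁, m₁⟩ := ih₁
    obtain ⟨T₂, s₂, n₂, r₂, m₂⟩ := ih₂
    refine ⟨insert (a, b) (T₁ ∪ T₂), ?_, ?_, by simp, ?_⟩
    · intro p hp
      rcases mem_insert.1 hp with rfl | hp
      · exact ⟨le_rfl, by simp only; omega, le_rfl, hR⟩
      · rcases mem_union.1 hp with hp | hp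
        · obtain ⟨x, y, z, w⟩ := s₁ p hp
          exact ⟨x, y, by omega, w⟩
        · obtain ⟨x, y, z, w⟩ := s₂ p hp
          exact ⟨by omega, y, z, w⟩
    · have key : ∀ p ∈ T₁ ∪ T₂, a ≤ p.1 ∧ p.2 ≤ b := by
        intro p hp
        rcases mem_union.1 hp with hp | hp
        · have := s₁ p hp; omega
        · have := s₂ p hp; omega
      intro p hp q hq
      rcases mem_insert.1 hp with rfl | hp
      · rcases mem_insert.1 hq with rfl | hq
        · simp
        · have := key q hq; simp only; omega
      · rcases mem_insert.1 hq with rfl | hq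
        · have := key p hp; simp only; omega
        · rcases mem_union.1 hp with hp | hp <;> rcases mem_union.1 hq with hq | hq
          · exact n₁ p hp q hq
          · have := s₁ p hp; have := s₂ q hq; omega
          · have := s₂ p hp; have := s₁ q hq; omega
          · exact n₂ p hp q hq
    · intro i j hi hij hj hn
      simp only [mem_insert, mem_union, Prod.mk.injEq, not_or] at hn
      obtain ⟨hne, hn₁, hn₂⟩ := hn
      by_cases hjc : j ≤ c
      · obtain ⟨p, hp, h⟩ := m₁ i j hi hij hjc hn₁
        exact ⟨p, by simp [hp], h⟩
      by_cases hci : c ≤ i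
      · obtain ⟨p, hp, h⟩ := m₂ i j hci hij hj hn₂
        exact ⟨p, by simp [hp], h⟩
      by_cases hai : a < i
      · exact ⟨(a, c), by simp [r₁ (by omega)], Or.inl (by simp only; omega)⟩
      · exact ⟨(c, b), by simp [r₂ (by omega)], Or.inr (by simp only; omega)⟩

end Fillable

section Bridge

variable {n : ℕ}

theorem sym2_natCast_inj {i j k l : ℕ} (hij : i < j) (hj : j < n) (hkl : k < l) (hl : l < n)
    (h : s((i : ZMod n), (j : ZMod n)) = s((k : ZMod n), (l : ZMod n))) : i = k ∧ j = l := by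
  have hi : (i : ZMod n).val = i := ZMod.val_cast_of_lt (by omega)
  have hj' : (j : ZMod n).val = j := ZMod.val_cast_of_lt hj
  have hk : (k : ZMod n).val = k := ZMod.val_cast_of_lt (by omega)
  have hl' : (l : ZMod n).val = l := ZMod.val_cast_of_lt hl
  rcases Sym2.eq_iff.1 h with ⟨h1, h2⟩ | ⟨h1, h2⟩
  · rw [← h1] at hk; rw [← h2] at hl'; omega
  · rw [← h1] at hl'; rw [← h2] at hk; omega

theorem IsDiagonal.isEdge {e : Sym2 (ZMod n)} (h : IsDiagonal n e) : IsEdge n e := by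
  obtain ⟨a, b, he, hab, -⟩ := h
  exact ⟨a, b, he, hab⟩

variable [NeZero n]

theorem val_sub_eq (a b : ZMod n) :
    (a - b).val = if b.val ≤ a.val then a.val - b.val else n + a.val - b.val := by
  split_ifs with h
  · exact ZMod.val_sub h
  · have hb := ZMod.val_lt b
    have ha := ZMod.val_lt a
    have h2 : (b - a).val = b.val - a.val := ZMod.val_sub (by omega)
    have hne : b - a ≠ 0 := by
      intro h0
      rw [h0, ZMod.val_zero] at h2
      omega
    have : (a - b) = -(b - a) := by ring
    rw [this, ZMod.neg_val, if_neg hne, h2]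
    omega

theorem exists_nat_pair {e : Sym2 (ZMod n)} (he : IsEdge n e) :
    ∃ i j : ℕ, i < j ∧ j < n ∧ e = s((i : ZMod n), (j : ZMod n)) := by
  obtain ⟨a, b, rfl, hab⟩ := he
  have hne : a.val ≠ b.val := fun h => hab (ZMod.val_injective n h)
  rcases lt_or_gt_of_ne hne with h | h
  · exact ⟨a.val, b.val, h, ZMod.val_lt b, by simp⟩
  · exact ⟨b.val, a.val, h, ZMod.val_lt a, by simp [Sym2.eq_swap]⟩

theorem cross_natCast_iff {i j k l : ℕ} (hij : i < j) (hj : j < n) (hkl : k < l) (hl : l < n) :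
    Cross n s((i : ZMod n), (j : ZMod n)) s((k : ZMod n), (l : ZMod n)) ↔
      (i < k ∧ k < j ∧ j < l) ∨ (k < i ∧ i < l ∧ l < j) := by
  have hi' : (i : ZMod n).val = i := ZMod.val_cast_of_lt (by omega)
  have hj' : (j : ZMod n).val = j := ZMod.val_cast_of_lt hj
  have hk' : (k : ZMod n).val = k := ZMod.val_cast_of_lt (by omega)
  have hl' : (l : ZMod n).val = l := ZMod.val_cast_of_lt hl
  constructor
  · rintro ⟨a, b, c, d, he, hf, h⟩
    simp only [val_sub_eq] at h
    rcases Sym2.eq_iff.1 he with ⟨rfl, rfl⟩ | ⟨rfl, rfl⟩ <;>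
      rcases Sym2.eq_iff.1 hf with ⟨rfl, rfl⟩ | ⟨rfl, rfl⟩ <;>
      rw [hi', hj', hk', hl'] at h <;> split_ifs at h <;> omega
  · rintro (h | h)
    · refine ⟨i, j, k, l, rfl, rfl, ?_⟩
      simp only [val_sub_eq, hi', hj', hk', hl']
      split_ifs <;> omega
    · refine ⟨i, j, l, k, rfl, Sym2.eq_swap, ?_⟩
      simp only [val_sub_eq, hi', hj', hk', hl']
      split_ifs <;> omega

theorem isDiagonal_natCast_iff {i j : ℕ} (hij : i < j) (hj : j < n) :
    IsDiagonal n s((i : ZMod n), (j : ZMod n)) ↔ i + 2 ≤ j ∧ j + 2 ≤ n + i := by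
  have hi' : (i : ZMod n).val = i := ZMod.val_cast_of_lt (by omega)
  have hj' : (j : ZMod n).val = j := ZMod.val_cast_of_lt hj
  constructor
  · rintro ⟨a, b, he, -, ⟨c, hc⟩, ⟨d, hd⟩⟩
    have hc' := ZMod.val_lt c
    have hd' := ZMod.val_lt d
    simp only [Btw, val_sub_eq] at hc hd
    rcases Sym2.eq_iff.1 he with ⟨rfl, rfl⟩ | ⟨rfl, rfl⟩ <;>
      rw [hi', hj'] at hc hd <;> split_ifs at hc hd <;> omega
  · rintro ⟨h1, h2⟩
    refine ⟨i, j, rfl, ?_, ⟨((i + 1 : ℕ) : ZMod n), ?_⟩, ?_⟩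
    · intro h
      rw [h] at hi'
      omega
    · have : ((i + 1 : ℕ) : ZMod n).val = i + 1 := ZMod.val_cast_of_lt (by omega)
      simp only [Btw, val_sub_eq, hi', hj', this]
      split_ifs <;> omega
    · by_cases hjn : j + 1 < n
      · refine ⟨((j + 1 : ℕ) : ZMod n), ?_⟩
        have : ((j + 1 : ℕ) : ZMod n).val = j + 1 := ZMod.val_cast_of_lt hjn
        simp only [Btw, val_sub_eq, hi', hj', this]
        split_ifs <;> omega
      · refine ⟨((0 : ℕ) : ZMod n), ?_⟩
        have : ((0 : ℕ) : ZMod n).val = 0 := ZMod.val_cast_of_lt (by omega)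
        simp only [Btw, val_sub_eq, hi', hj', this]
        split_ifs <;> omega

theorem exists_triangulation_of_fillable {R : ℕ → ℕ → Prop} (h : Fillable R 0 (n - 1)) :
    ∃ T, IsTriangulation n T ∧
      ∀ e ∈ T, ∃ i j : ℕ, i < j ∧ j < n ∧ R i j ∧ e = s((i : ZMod n), (j : ZMod n)) := by
  classical
  obtain ⟨T, hs, hn, -, hm⟩ := h.exists_maximal
  have hlt := h.lt
  refine ⟨(T.erase (0, n - 1)).image fun p => s((p.1 : ZMod n), (p.2 : ZMod n)), ⟨?_, ?_, ?_⟩, ?_⟩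
  · intro e he
    obtain ⟨⟨i, j⟩, hp, rfl⟩ := mem_image.1 he
    rw [mem_erase] at hp
    have := hs _ hp.2
    have hne : ¬ (i = 0 ∧ j = n - 1) := fun hh => hp.1 (by rw [hh.1, hh.2])
    simp only at this ⊢
    rw [isDiagonal_natCast_iff (by omega) (by omega)]
    omega
  · intro e he f hf
    obtain ⟨p, hp, rfl⟩ := mem_image.1 he
    obtain ⟨q, hq, rfl⟩ := mem_image.1 hf
    have hp := (mem_erase.1 hp).2
    have hq := (mem_erase.1 hq).2
    have := hs _ hp
    have := hs _ hq
    rw [cross_natCast_iff (by omega) (by omega) (by omega) (by omega)]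
    have := hn p hp q hq
    have := hn q hq p hp
    tauto
  · intro e he hnot
    obtain ⟨i, j, hij, hj, rfl⟩ := exists_nat_pair he.isEdge
    rw [isDiagonal_natCast_iff hij hj] at he
    have hT : (i, j) ∉ T := by
      intro hT
      refine hnot (mem_image.2 ⟨(i, j), mem_erase.2 ⟨?_, hT⟩, rfl⟩)
      simp only [ne_eq, Prod.mk.injEq]
      omega
    obtain ⟨p, hp, hx⟩ := hm i j (by omega) he.1 (by omega) hT
    have hb := hs p hp
    refine ⟨_, mem_image.2 ⟨p, mem_erase.2 ⟨?_, hp⟩, rfl⟩, ?_⟩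
    · rintro rfl
      simp only at hx
      omega
    · rw [cross_natCast_iff (by omega) (by omega) (by omega) (by omega)]
      tauto
  · intro e he
    obtain ⟨p, hp, rfl⟩ := mem_image.1 he
    have := hs _ (mem_erase.1 hp).2
    exact ⟨p.1, p.2, by omega, by omega, this.2.2.2, rfl⟩

theorem IsTriangulation.fillable {T : Finset (Sym2 (ZMod n))} (hT : IsTriangulation n T)
    (hn : 2 ≤ n) :
    Fillable (fun i j => s((i : ZMod n), (j : ZMod n)) ∈ T ∨ (i = 0 ∧ j = n - 1)) 0 (n - 1) := by
  classical
  obtain ⟨hd, hc, hm⟩ := hT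
  set R : ℕ → ℕ → Prop := fun i j => s((i : ZMod n), (j : ZMod n)) ∈ T ∨ (i = 0 ∧ j = n - 1)
    with hR
  suffices H : ∀ d a b : ℕ, b = a + d → b < n → a < b → (b = a + 1 ∨ R a b) → Fillable R a b by
    exact H (n - 1) 0 (n - 1) (by omega) (by omega) (by omega) (Or.inr (Or.inr ⟨rfl, rfl⟩))
  intro d
  induction d using Nat.strong_induction_on with
  | _ d ih =>
    intro a b hb hbn hab hR'
    by_cases hside : b = a + 1
    · subst hside; exact Fillable.side a
    have hab' : R a b := hR'.resolve_left hside
    -- the farthest neighbour of `a` inside the arc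
    let S := (Finset.Ioo a b).filter fun c => c = a + 1 ∨ R a c
    have hSne : S.Nonempty := ⟨a + 1, mem_filter.2 ⟨mem_Ioo.2 ⟨by omega, by omega⟩, Or.inl rfl⟩⟩
    obtain ⟨c, hcS, hcmax⟩ : ∃ c ∈ S, ∀ x ∈ S, x ≤ c :=
      ⟨S.max' hSne, S.max'_mem hSne, fun x hx => S.le_max' x hx⟩
    simp only [S, mem_filter, mem_Ioo] at hcS hcmax
    obtain ⟨⟨hac, hcb⟩, hcR⟩ := hcS
    refine Fillable.tri hab' (ih (c - a) (by omega) a c (by omega) (by omega) hac hcR)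
      (ih (b - c) (by omega) c b (by omega) hbn hcb ?_)
    by_contra hcon
    rw [not_or] at hcon
    obtain ⟨hc1, hc2⟩ := hcon
    rw [hR] at hc2
    simp only [not_or] at hc2
    obtain ⟨f, hf, hcr⟩ := hm s((c : ZMod n), (b : ZMod n))
      ((isDiagonal_natCast_iff hcb hbn).2 ⟨by omega, by omega⟩) hc2.1
    obtain ⟨p, q, hpq, hq, rfl⟩ := exists_nat_pair (hd f hf).isEdge
    rw [cross_natCast_iff hcb hbn hpq hq] at hcr
    have hab'' : ¬ ((a < p ∧ p < b ∧ b < q) ∨ (p < a ∧ a < q ∧ q < b)) := by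
      rcases hab' with h | h
      · rw [← cross_natCast_iff hab hbn hpq hq]
        exact hc _ h _ hf
      · omega
    have hac'' : c = a + 1 ∨ ¬ ((a < p ∧ p < c ∧ c < q) ∨ (p < a ∧ a < q ∧ q < c)) := by
      rcases hcR with h | h | h
      · exact Or.inl h
      · right
        rw [← cross_natCast_iff hac (by omega) hpq hq]
        exact hc _ h _ hf
      · omega
    have hpa : p = a ∧ c < q ∧ q < b := by omega
    obtain ⟨rfl, hcq, hqb⟩ := hpa
    have := hcmax q ⟨⟨hpq, hqb⟩, Or.inr (Or.inl hf)⟩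
    omega

/-- A set of pairs `i < j < n` which is hit by every filling of the polygon and each of whose
members is needed for that yields a saturated blocker. -/
theorem exists_saturatedBlocker (hn : 4 ≤ n) (D : Finset (ℕ × ℕ))
    (hD : ∀ p ∈ D, p.1 + 2 ≤ p.2 ∧ p.2 + 2 ≤ n + p.1 ∧ p.2 < n)
    (hblock : ¬ Fillable (fun i j => (i, j) ∉ D) 0 (n - 1))
    (hsat : ∀ p ∈ D, Fillable (fun i j => (i, j) ∉ D ∨ (i, j) = p) 0 (n - 1)) :
    ∃ B : Finset (Sym2 (ZMod n)), IsSaturatedBlocker n B ∧ B.card = D.card := by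
  classical
  have hmem : ∀ i j : ℕ, i < j → j < n →
      (s((i : ZMod n), (j : ZMod n)) ∈ D.image (fun p => s((p.1 : ZMod n), (p.2 : ZMod n))) ↔
        (i, j) ∈ D) := by
    intro i j hij hj
    constructor
    · intro h
      obtain ⟨p, hp, h⟩ := mem_image.1 h
      have := hD p hp
      obtain ⟨h1, h2⟩ := sym2_natCast_inj (by omega) (by omega) hij hj h
      rw [← h1, ← h2]
      exact hp
    · intro h
      exact mem_image.2 ⟨(i, j), h, rfl⟩
  refine ⟨D.image fun p => s((p.1 : ZMod n), (p.2 : ZMod n)), ⟨⟨?_, ?_⟩, ?_⟩, ?_⟩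
  · intro e he
    obtain ⟨p, hp, rfl⟩ := mem_image.1 he
    have := hD p hp
    exact ((isDiagonal_natCast_iff (by omega) (by omega)).2 ⟨by omega, by omega⟩).isEdge
  · intro T hT
    by_contra hcon
    rw [not_nonempty_iff_eq_empty, ← disjoint_iff_inter_eq_empty, disjoint_left] at hcon
    refine hblock ((hT.fillable (by omega)).mono ?_)
    rintro i j (h | ⟨rfl, rfl⟩) hmemD
    · exact hcon (mem_image.2 ⟨(i, j), hmemD, rfl⟩) h
    · have := hD _ hmemD
      simp only at this
      omega
  · intro e he hbl
    obtain ⟨p, hp, rfl⟩ := mem_image.1 he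
    obtain ⟨T, hT, hTR⟩ := exists_triangulation_of_fillable (hsat p hp)
    obtain ⟨f, hf⟩ := hbl.2 T hT
    rw [mem_inter, mem_erase] at hf
    obtain ⟨i, j, hij, hj, hR, rfl⟩ := hTR f hf.2
    rcases hR with h | h
    · exact h ((hmem i j hij hj).1 hf.1.2)
    · exact hf.1.1 (by rw [← h])
  · refine card_image_of_injOn ?_
    intro p hp q hq h
    have := hD p hp
    have := hD q hq
    obtain ⟨h1, h2⟩ := sym2_natCast_inj (by omega) (by omega) (by omega) (by omega) h
    exact Prod.ext h1 h2

end Bridge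

theorem Fillable.of_exists_mid {R R' : ℕ → ℕ → Prop} (hRR' : ∀ i j, R i j → R' i j) {a b : ℕ}
    (hmid : ∀ i j, a ≤ i → i + 2 ≤ j → j ≤ b → ∃ c, i < c ∧ c < j ∧ R i c ∧ R c j) {i j : ℕ}
    (hi : a ≤ i) (hij : i < j) (hj : j ≤ b) (h : R' i j) : Fillable R' i j := by
  have key : ∀ d i j, j = i + d → a ≤ i → i < j → j ≤ b → R' i j → Fillable R' i j := by
    intro d
    induction d using Nat.strong_induction_on with
    | _ d ih =>
      intro i j hd hi hij hj h
      by_cases hside : j = i + 1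
      · subst hside; exact Fillable.side i
      obtain ⟨c, hic, hcj, h1, h2⟩ := hmid i j hi (by omega) hj
      exact .tri h (ih (c - i) (by omega) i c (by omega) hi hic (by omega) (hRR' _ _ h1))
        (ih (j - c) (by omega) c j (by omega) (by omega) hcj hj (hRR' _ _ h2))
  exact key (j - i) i j (by omega) hi hij hj h

/-- Vertices `x < N` and `s ∈ [N, n)` form two opposite chains of the `n`-gon.  The chords
`(x, s)` between the chains are sorted into those reachable from the side `(0, n - 1)`
(the relation `A`), those from which the side `(N - 1, N)` is reachable (the relation `Z`), and
the removed ones; a chord within a chain is removed if it would make a `Z`-chord reachable from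
an `A`-chord. -/
def Removed (N n : ℕ) (A Z : ℕ → ℕ → Prop) (i j : ℕ) : Prop :=
  i < j ∧ j < n ∧
    ((j < N ∧ ∃ s, N ≤ s ∧ s < n ∧ A i s ∧ Z j s) ∨ (i < N ∧ N ≤ j ∧ ¬ A i j ∧ ¬ Z i j) ∨
      (N ≤ i ∧ ∃ x < N, A x j ∧ Z x i))

section TwoChains

variable {N n : ℕ} {A Z : ℕ → ℕ → Prop}

theorem not_fillable_of_disjoint (hN : 0 < N) (hNn : N < n)
    (hdisj : ∀ x s, x < N → N ≤ s → s < n → ¬ (A x s ∧ Z x s))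
    (hZ : Z (N - 1) N) (hA : A 0 (n - 1))
    (hside : ∀ i, i + 1 < n → ¬ Removed N n A Z i (i + 1)) :
    ¬ Fillable (fun i j => ¬ Removed N n A Z i j) 0 (n - 1) := by
  have ok : ∀ a b, b < n → Fillable (fun i j => ¬ Removed N n A Z i j) a b →
      ¬ Removed N n A Z a b := by
    intro a b hb h
    cases h with
    | side => exact hside _ hb
    | tri h => exact h
  have key : ∀ x s, Fillable (fun i j => ¬ Removed N n A Z i j) x s → s < n → x < N → N ≤ s →
      A x s → False := by
    intro x s h
    induction h with
    | side a =>
      intro h1 h2 h3 h4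
      obtain rfl : a = N - 1 := by omega
      have : N - 1 + 1 = N := by omega
      rw [this] at h4
      exact hdisj _ _ h2 le_rfl hNn ⟨h4, hZ⟩
    | @tri x c s hR h₁ h₂ ih₁ ih₂ =>
      intro hs hx hNs hAxs
      have hxc := h₁.lt
      have hcs := h₂.lt
      have r₁ := ok _ _ (by omega) h₁
      have r₂ := ok _ _ hs h₂
      simp only [Removed, not_and, not_or, not_exists, not_not] at r₁ r₂
      by_cases hc : c < N
      · refine ih₂ hs hc hNs ?_
        by_contra hAc
        have hZc : Z c s := (r₂ hcs hs).2.1 hc hNs hAc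
        exact (r₁ hxc (by omega)).1 hc s hNs hs hAxs hZc
      · refine ih₁ (by omega) hx (by omega) ?_
        by_contra hAc
        have hZc : Z x c := (r₁ hxc (by omega)).2.1 hx (by omega) hAc
        exact (r₂ hcs hs).2.2 (by omega) x hx hAxs hZc
  intro h
  exact key _ _ h (by omega) hN (by omega) hA

theorem fillable_insert_of_removed (hNn : N < n)
    (hZ : ∀ x < N, Z x N) (hA : ∀ x < N, A x (n - 1))
    (hsucc : ∀ x s, x < N → N < s → s < n → ¬ A x s →
      ∃ s', N ≤ s' ∧ s' < s ∧ Z x s' ∧ ¬ Removed N n A Z s' s)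
    (hpred : ∀ x s, x < N → N ≤ s → s < n - 1 → ¬ Z x s →
      ∃ s', s < s' ∧ s' < n ∧ A x s' ∧ ¬ Removed N n A Z s s')
    (hdisj : ∀ x s, x < N → N ≤ s → s < n → ¬ (A x s ∧ Z x s))
    (hmidX : ∀ i j, i + 2 ≤ j → j < N →
      ∃ c, i < c ∧ c < j ∧ ¬ Removed N n A Z i c ∧ ¬ Removed N n A Z c j)
    (hmidS : ∀ i j, N ≤ i → i + 2 ≤ j → j < n →
      ∃ c, i < c ∧ c < j ∧ ¬ Removed N n A Z i c ∧ ¬ Removed N n A Z c j)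
    {i j : ℕ} (hij : Removed N n A Z i j) :
    Fillable (fun a b => ¬ Removed N n A Z a b ∨ (a, b) = (i, j)) 0 (n - 1) := by
  set R' : ℕ → ℕ → Prop := fun a b => ¬ Removed N n A Z a b ∨ (a, b) = (i, j) with hR'
  have hRR' : ∀ a b, ¬ Removed N n A Z a b → R' a b := fun a b h => Or.inl h
  have fX : ∀ a b, a < b → b < N → R' a b → Fillable R' a b := fun a b hab hb h =>
    Fillable.of_exists_mid (a := 0) (b := N - 1) hRR'
      (fun i j _ h1 h2 => hmidX i j h1 (by omega)) (by omega) hab (by omega) h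
  have fS : ∀ a b, N ≤ a → a < b → b < n → R' a b → Fillable R' a b := fun a b ha hab hb h =>
    Fillable.of_exists_mid (a := N) (b := n - 1) hRR'
      (fun i j h0 h1 h2 => hmidS i j h0 h1 (by omega)) ha hab (by omega) h
  have okA : ∀ x s, x < N → N ≤ s → A x s → R' x s := by
    intro x s hx hs h
    left
    rintro ⟨-, -, h' | h' | h'⟩
    · omega
    · exact h'.2.2.1 h
    · omega
  have okZ : ∀ x s, x < N → N ≤ s → Z x s → R' x s := by
    intro x s hx hs h
    left
    rintro ⟨-, -, h' | h' | h'⟩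
    · omega
    · exact h'.2.2.2 h
    · omega
  have fN : ∀ d x, x + d + 1 = N → Fillable R' x N := by
    intro d
    induction d with
    | zero =>
      intro x hx
      obtain rfl : N = x + 1 := by omega
      exact Fillable.side x
    | succ d ih =>
      intro x hx
      exact .tri (okZ x N (by omega) le_rfl (hZ x (by omega))) (Fillable.side x)
        (ih (x + 1) (by omega))
  have fZ : ∀ x s, x < N → N ≤ s → s < n → Z x s → Fillable R' x s := by
    intro x s
    induction s using Nat.strong_induction_on with
    | _ s ih =>
      intro hx hs hsn h
      rcases eq_or_lt_of_le hs with rfl | hs'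
      · exact fN (N - 1 - x) x (by omega)
      · obtain ⟨s', h1, h2, h3, h4⟩ := hsucc x s hx hs' hsn
          (fun hA' => hdisj x s hx hs hsn ⟨hA', h⟩)
        exact .tri (okZ x s hx hs h) (ih s' h2 hx h1 (by omega) h3) (fS s' s h1 h2 hsn (Or.inl h4))
  have fTop : ∀ x, x < N → Fillable R' x (n - 1) → Fillable R' 0 (n - 1) := by
    intro x
    induction x with
    | zero => exact fun _ h => h
    | succ x ih =>
      intro hx h
      exact ih (by omega) (.tri (okA x _ (by omega) (by omega) (hA x (by omega)))
        (Fillable.side x) h)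
  have fA : ∀ d x s, s + d + 1 = n → x < N → N ≤ s → A x s → Fillable R' x s →
      Fillable R' 0 (n - 1) := by
    intro d
    induction d using Nat.strong_induction_on with
    | _ d ih =>
      intro x s hd hx hs h hf
      by_cases hlast : s = n - 1
      · subst hlast; exact fTop x hx hf
      obtain ⟨s', h1, h2, h3, h4⟩ := hpred x s hx hs (by omega)
          (fun hZ' => hdisj x s hx hs (by omega) ⟨h, hZ'⟩)
      exact ih (n - 1 - s') (by omega) x s' (by omega) hx (by omega) h3
        (.tri (okA x s' hx (by omega) h3) hf (fS s s' hs h1 h2 (Or.inl h4)))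
  have hself : R' i j := Or.inr rfl
  obtain ⟨hlt, hjn, ⟨hj, s, hs, hsn, hAs, hZs⟩ | ⟨hi, hj, hnA, hnZ⟩ | ⟨hi, x, hx, hAx, hZx⟩⟩ := hij
  · exact fA (n - 1 - s) i s (by omega) (by omega) hs hAs
      (.tri (okA i s (by omega) hs hAs) (fX i j hlt hj hself) (fZ j s hj hs hsn hZs))
  · have hjN : N ≠ j := by rintro rfl; exact hnZ (hZ i hi)
    have hjn' : j ≠ n - 1 := by rintro rfl; exact hnA (hA i hi)
    obtain ⟨s, h1, h2, h3, h4⟩ := hsucc i j hi (by omega) hjn hnA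
    obtain ⟨s', h1', h2', h3', h4'⟩ := hpred i j hi hj (by omega) hnZ
    exact fA (n - 1 - s') i s' (by omega) hi (by omega) h3'
      (.tri (okA i s' hi (by omega) h3')
        (.tri hself (fZ i s hi h1 (by omega) h3) (fS s j h1 h2 hjn (Or.inl h4)))
        (fS j s' hj h1' h2' (Or.inl h4')))
  · exact fA (n - 1 - j) x j (by omega) hx (by omega) hAx
      (.tri (okA x j hx (by omega) hAx) (fZ x i hx hi (by omega) hZx) (fS i j hi hlt hjn hself))

end TwoChains

/-- The chords reachable from the side `(0, n - 1)`. -/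
def StartRel (N H : ℕ) (b U : ℕ → ℕ → Prop) (x s : ℕ) : Prop :=
  (∃ q < H, s = N + H + 2 + 2 * q ∧ b q x) ∨ ∃ r, s = N + 3 * H + 2 + r ∧ U r x

/-- The chords from which the side `(N - 1, N)` is reachable. -/
def EndRel (N H : ℕ) (b g : ℕ → ℕ → Prop) (x s : ℕ) : Prop :=
  s = N ∨ (∃ q < H, s = N + q + 1 ∧ ¬ b q x) ∨ ∃ q < H, s = N + H + 2 + 2 * q ∧ g q x

/-- The pair `(i, j)` is separated by one of the first `H` pairs `(b q, g q)`. -/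
def Separated (H : ℕ) (b g : ℕ → ℕ → Prop) (i j : ℕ) : Prop :=
  ∃ q < H, b q i ∧ g q j

open Classical in
/-- The pairs of vertices removed in the construction with `N` vertices on the first chain,
`H` separating pairs and `Y + 1` further vertices described by `U`. -/
noncomputable def removedPairs (N H Y : ℕ) (b g U : ℕ → ℕ → Prop) : Finset (ℕ × ℕ) :=
  (range (N + 3 * H + 3 + Y) ×ˢ range (N + 3 * H + 3 + Y)).filter fun p =>
    Removed N (N + 3 * H + 3 + Y) (StartRel N H b U) (EndRel N H b g) p.1 p.2

section Construction

variable {N H Y : ℕ} {b g U : ℕ → ℕ → Prop}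

theorem mem_removedPairs {i j : ℕ} : (i, j) ∈ removedPairs N H Y b g U ↔
    Removed N (N + 3 * H + 3 + Y) (StartRel N H b U) (EndRel N H b g) i j := by
  simp only [removedPairs, mem_filter, mem_product, mem_range, and_iff_right_iff_imp]
  rintro ⟨h1, h2, -⟩
  omega

theorem StartRel.pos {x s : ℕ} (h : StartRel N H b U x s) :
    (∃ q < H, s = N + H + 2 + 2 * q) ∨ N + 3 * H + 2 ≤ s := by
  rcases h with ⟨q, hq, h, -⟩ | ⟨r, h, -⟩
  · exact Or.inl ⟨q, hq, h⟩
  · right; omega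

theorem EndRel.pos {x s : ℕ} (h : EndRel N H b g x s) :
    s ≤ N + H ∨ ∃ q < H, s = N + H + 2 + 2 * q := by
  rcases h with h | ⟨q, hq, h, -⟩ | ⟨q, hq, h, -⟩
  · left; omega
  · left; omega
  · exact Or.inr ⟨q, hq, h⟩

theorem startRel_hub {x q : ℕ} (hq : q < H) : StartRel N H b U x (N + H + 2 + 2 * q) ↔ b q x := by
  constructor
  · rintro (⟨q', hq', h, hb⟩ | ⟨r, h, hb⟩)
    · obtain rfl : q = q' := by omega
      exact hb
    · omega
  · exact fun h => Or.inl ⟨q, hq, rfl, h⟩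

theorem startRel_last {x r : ℕ} : StartRel N H b U x (N + 3 * H + 2 + r) ↔ U r x := by
  constructor
  · rintro (⟨q', hq', h, hb⟩ | ⟨r', h, hb⟩)
    · omega
    · obtain rfl : r = r' := by omega
      exact hb
  · exact fun h => Or.inr ⟨r, rfl, h⟩

theorem endRel_hub {x q : ℕ} (hq : q < H) : EndRel N H b g x (N + H + 2 + 2 * q) ↔ g q x := by
  constructor
  · rintro (h | ⟨q', hq', h, hb⟩ | ⟨q', hq', h, hb⟩)
    · omega
    · omega
    · obtain rfl : q = q' := by omega
      exact hb
  · exact fun h => Or.inr (Or.inr ⟨q, hq, rfl, h⟩)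

theorem endRel_first {x q : ℕ} (hq : q < H) : EndRel N H b g x (N + q + 1) ↔ ¬ b q x := by
  constructor
  · rintro (h | ⟨q', hq', h, hb⟩ | ⟨q', hq', h, hb⟩)
    · omega
    · obtain rfl : q = q' := by omega
      exact hb
    · omega
  · exact fun h => Or.inr (Or.inl ⟨q, hq, rfl, h⟩)

theorem removed_iff_separated {n i j : ℕ} (hn : N + 3 * H + 3 ≤ n) (hij : i < j) (hj : j < N) :
    Removed N n (StartRel N H b U) (EndRel N H b g) i j ↔ Separated H b g i j := by
  constructor
  · rintro ⟨-, -, ⟨-, s, hs, -, hA, hZ⟩ | h | h⟩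
    · rcases hZ.pos with h | ⟨q, hq, rfl⟩
      · rcases hA.pos with ⟨q, hq, rfl⟩ | h' <;> omega
      · exact ⟨q, hq, (startRel_hub hq).1 hA, (endRel_hub hq).1 hZ⟩
    · omega
    · omega
  · rintro ⟨q, hq, hb, hg⟩
    exact ⟨hij, by omega, Or.inl ⟨hj, N + H + 2 + 2 * q, by omega, by omega,
      (startRel_hub hq).2 hb, (endRel_hub hq).2 hg⟩⟩

theorem exists_saturatedBlocker_removedPairs {n : ℕ} (hn : n = N + 3 * H + 3 + Y) (hN : 0 < N)
    (hHY : H ≤ Y) (hdisj : ∀ q < H, ∀ x < N, ¬ (b q x ∧ g q x)) (hUtop : ∀ x < N, U Y x)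
    (hUg : ∀ q < H, ∀ x < N, U q x ↔ ¬ g q x)
    (hU : ∀ r < Y, ∀ x < N, ¬ U r x → ∃ q < H, g q x ∧ ∀ x' < N, U r x' → ¬ g q x')
    (hside : ∀ i, i + 1 < N → ¬ Separated H b g i (i + 1))
    (hmid : ∀ i j, i + 2 ≤ j → j < N →
      ∃ c, i < c ∧ c < j ∧ ¬ Separated H b g i c ∧ ¬ Separated H b g c j) :
    ∃ B : Finset (Sym2 (ZMod n)), IsSaturatedBlocker n B ∧
      B.card = (removedPairs N H Y b g U).card := by
  have : NeZero n := ⟨by omega⟩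
  have hn4 : 4 ≤ n := by omega
  set A := StartRel N H b U with hA
  set Z := EndRel N H b g with hZ
  have hmem : ∀ i j, (i, j) ∈ removedPairs N H Y b g U ↔ Removed N n A Z i j := by
    intro i j; rw [mem_removedPairs, hn]
  have allowed : ∀ s s', N ≤ s → (∀ x < N, A x s' → ¬ Z x s) → ¬ Removed N n A Z s s' := by
    rintro s s' hs h ⟨h1, -, h2 | h2 | ⟨-, x, hx, hx1, hx2⟩⟩
    · omega
    · omega
    · exact h x hx hx1 hx2
  have allowedZ : ∀ s s', N ≤ s → ¬ (s ≤ N + H ∨ ∃ q < H, s = N + H + 2 + 2 * q) →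
      ¬ Removed N n A Z s s' := fun s s' hs h => allowed s s' hs fun x _ _ hz => h hz.pos
  have allowedA : ∀ s s', N ≤ s → ¬ ((∃ q < H, s' = N + H + 2 + 2 * q) ∨ N + 3 * H + 2 ≤ s') →
      ¬ Removed N n A Z s s' := fun s s' hs h => allowed s s' hs fun x _ ha _ => h ha.pos
  have hZN : ∀ x < N, Z x N := fun x _ => Or.inl rfl
  have hAn : ∀ x < N, A x (n - 1) := by
    intro x hx
    have : n - 1 = N + 3 * H + 2 + Y := by omega
    rw [this, hA, startRel_last]
    exact hUtop x hx
  have hAZ : ∀ x s, x < N → N ≤ s → s < n → ¬ (A x s ∧ Z x s) := by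
    rintro x s hx hs hsn ⟨ha, hz⟩
    rcases hz.pos with h | ⟨q, hq, rfl⟩
    · rcases ha.pos with ⟨q, hq, rfl⟩ | h' <;> omega
    · exact hdisj q hq x hx ⟨(startRel_hub hq).1 ha, (endRel_hub hq).1 hz⟩
  have hside' : ∀ i, i + 1 < n → ¬ Removed N n A Z i (i + 1) := by
    intro i hi
    rcases lt_trichotomy (i + 1) N with h | h | h
    · rw [hA, hZ, removed_iff_separated (by omega) (by omega) h]
      exact hside i h
    · rintro ⟨-, -, h' | h' | h'⟩
      · omega
      · apply h'.2.2.2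
        rw [h]
        exact hZN _ (by omega)
      · omega
    · refine allowed _ _ (by omega) fun x _ ha hz => ?_
      rcases hz.pos with h1 | ⟨q, hq, h1⟩ <;> rcases ha.pos with ⟨q', hq', h2⟩ | h2 <;> omega
  have hblock := not_fillable_of_disjoint hN (by omega) hAZ (hZN _ (by omega)) (hAn 0 hN) hside'
  have hsucc : ∀ x s, x < N → N < s → s < n → ¬ A x s →
      ∃ s', N ≤ s' ∧ s' < s ∧ Z x s' ∧ ¬ Removed N n A Z s' s := by
    intro x s hx hs hsn hnA
    by_cases h1 : (∃ q < H, s = N + H + 2 + 2 * q) ∨ N + 3 * H + 2 ≤ s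
    · rcases h1 with ⟨q, hq, rfl⟩ | h1
      · rw [hA, startRel_hub hq] at hnA
        refine ⟨N + q + 1, by omega, by omega, (endRel_first hq).2 hnA,
          allowed _ _ (by omega) fun y _ ha hz => ?_⟩
        exact (endRel_first hq).1 hz ((startRel_hub hq).1 ha)
      · obtain ⟨r, rfl⟩ : ∃ r, s = N + 3 * H + 2 + r := ⟨s - (N + 3 * H + 2), by omega⟩
        rw [hA, startRel_last] at hnA
        have hr : r < Y := by
          by_contra hr
          obtain rfl : r = Y := by omega
          exact hnA (hUtop x hx)
        obtain ⟨q, hq, hg, hq'⟩ := hU r hr x hx hnA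
        refine ⟨N + H + 2 + 2 * q, by omega, by omega, (endRel_hub hq).2 hg,
          allowed _ _ (by omega) fun y hy ha hz => ?_⟩
        exact hq' y hy (startRel_last.1 ha) ((endRel_hub hq).1 hz)
    · exact ⟨N, le_rfl, hs, hZN x hx, allowedA _ _ le_rfl h1⟩
  have hpred : ∀ x s, x < N → N ≤ s → s < n - 1 → ¬ Z x s →
      ∃ s', s < s' ∧ s' < n ∧ A x s' ∧ ¬ Removed N n A Z s s' := by
    intro x s hx hs hsn hnZ
    by_cases h1 : s ≤ N + H ∨ ∃ q < H, s = N + H + 2 + 2 * q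
    · rcases h1 with h1 | ⟨q, hq, rfl⟩
      · have hsN : s ≠ N := by rintro rfl; exact hnZ (hZN x hx)
        obtain ⟨q, rfl⟩ : ∃ q, s = N + q + 1 := ⟨s - (N + 1), by omega⟩
        have hq : q < H := by omega
        rw [hZ, endRel_first hq, not_not] at hnZ
        refine ⟨N + H + 2 + 2 * q, by omega, by omega, (startRel_hub hq).2 hnZ,
          allowed _ _ (by omega) fun y _ ha hz => ?_⟩
        exact (endRel_first hq).1 hz ((startRel_hub hq).1 ha)
      · rw [hZ, endRel_hub hq] at hnZ
        refine ⟨N + 3 * H + 2 + q, by omega, by omega,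
          startRel_last.2 ((hUg q hq x hx).2 hnZ), allowed _ _ (by omega) fun y hy ha hz => ?_⟩
        exact (hUg q hq y hy).1 (startRel_last.1 ha) ((endRel_hub hq).1 hz)
    · exact ⟨n - 1, hsn, by omega, hAn x hx, allowedZ _ _ hs h1⟩
  have hmidX : ∀ i j, i + 2 ≤ j → j < N →
      ∃ c, i < c ∧ c < j ∧ ¬ Removed N n A Z i c ∧ ¬ Removed N n A Z c j := by
    intro i j hij hj
    obtain ⟨c, h1, h2, h3, h4⟩ := hmid i j hij hj
    refine ⟨c, h1, h2, ?_, ?_⟩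
    · rwa [hA, hZ, removed_iff_separated (by omega) h1 (by omega)]
    · rwa [hA, hZ, removed_iff_separated (by omega) h2 (by omega)]
  have hmidS : ∀ i j, N ≤ i → i + 2 ≤ j → j < n →
      ∃ c, i < c ∧ c < j ∧ ¬ Removed N n A Z i c ∧ ¬ Removed N n A Z c j := by
    intro i j hi hij hj
    by_cases c1 : i ≤ N + H
    · by_cases c2 : N + H + 2 ≤ j
      · refine ⟨N + H + 1, by omega, by omega, allowedA _ _ hi ?_, allowedZ _ _ (by omega) ?_⟩
        · rintro (⟨q, hq, h⟩ | h) <;> omega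
        · rintro (h | ⟨q, hq, h⟩) <;> omega
      · refine ⟨i + 1, by omega, by omega, allowedA _ _ hi ?_, allowedA _ _ (by omega) ?_⟩
        · rintro (⟨q, hq, h⟩ | h) <;> omega
        · rintro (⟨q, hq, h⟩ | h) <;> omega
    · by_cases c2 : ∃ q < H, i = N + H + 2 + 2 * q
      · obtain ⟨q, hq, rfl⟩ := c2
        refine ⟨N + H + 2 + 2 * q + 1, by omega, by omega, hside' _ (by omega),
          allowedZ _ _ (by omega) ?_⟩
        rintro (h | ⟨q', hq', h⟩) <;> omega
      · refine ⟨j - 1, by omega, by omega, allowedZ _ _ hi ?_, ?_⟩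
        · rintro (h | h)
          · exact c1 h
          · exact c2 h
        · have := hside' (j - 1) (by omega)
          rwa [show j - 1 + 1 = j by omega] at this
  refine exists_saturatedBlocker hn4 _ ?_ ?_ ?_
  · rintro ⟨i, j⟩ hp
    rw [hmem] at hp
    have h1 := hp.1
    have h2 := hp.2.1
    have h3 : j ≠ i + 1 := by rintro rfl; exact hside' _ h2 hp
    have h4 : ¬ (i = 0 ∧ j = n - 1) := by
      rintro ⟨rfl, rfl⟩
      rcases hp.2.2 with h | h | h
      · omega
      · exact h.2.2.1 (hAn 0 hN)
      · omega
    simp only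
    omega
  · simpa only [hmem] using hblock
  · rintro ⟨i, j⟩ hp
    rw [hmem] at hp
    simpa only [hmem] using
      fillable_insert_of_removed (by omega) hZN hAn hsucc hpred hAZ hmidX hmidS hp

end Construction

/-- The `p`-th block: consecutive even numbers, `2 ^ p + 1` of them. -/
def block (p : ℕ) : Finset ℕ :=
  (Ico (2 ^ p + p) (2 ^ (p + 1) + p + 1)).image (2 * ·)

theorem card_block (p : ℕ) : #(block p) = 2 ^ p + 1 := by
  rw [block, card_image_of_injective _ (mul_right_injective₀ two_ne_zero), Nat.card_Ico, pow_succ]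
  omega

theorem mem_block {p x : ℕ} :
    x ∈ block p ↔ x % 2 = 0 ∧ 2 ^ p + p ≤ x / 2 ∧ x / 2 < 2 ^ (p + 1) + p + 1 := by
  simp only [block, mem_image, mem_Ico]
  constructor
  · rintro ⟨m, hm, rfl⟩
    omega
  · intro h
    exact ⟨x / 2, h.2, by omega⟩

theorem block_eq_of_mem {p q x : ℕ} (hp : x ∈ block p) (hq : x ∈ block q) : p = q := by
  rw [mem_block] at hp hq
  rcases lt_trichotomy p q with h | h | h
  · have := Nat.pow_le_pow_right (n := 2) (by norm_num) (Nat.succ_le_of_lt h)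
    grind
  · exact h
  · have := Nat.pow_le_pow_right (n := 2) (by norm_num) (Nat.succ_le_of_lt h)
    grind

theorem disjoint_block {p q : ℕ} (h : p ≠ q) : Disjoint (block p) (block q) :=
  disjoint_left.2 fun _ hp hq => h (block_eq_of_mem hp hq)

theorem lt_of_mem_block {N P p x : ℕ} (hN : 2 * (2 ^ P + P) ≤ N) (hp : p < P)
    (hx : x ∈ block p) : x < N := by
  rw [mem_block] at hx
  have := Nat.pow_le_pow_right (n := 2) (by norm_num) (Nat.succ_le_of_lt hp)
  grind

theorem block_nonempty (p : ℕ) : (block p).Nonempty := by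
  rw [← card_pos, card_block]
  exact Nat.succ_pos _

/-- The left class of the `q`-th separating pair. -/
def leftClass (L q x : ℕ) : Prop := q < L ∧ x / 2 ^ q % 2 = 0 ∧ ¬ 2 ^ q ∣ x

/-- The right class of the `q`-th separating pair: for `q < L` it is read off the binary digits,
for `q ≥ L` it is a block. -/
def rightClass (L q x : ℕ) : Prop :=
  (q < L ∧ x / 2 ^ q % 2 = 1 ∧ ¬ 2 ^ q ∣ x) ∨ (L ≤ q ∧ x ∈ block (q - L))

/-- The classes of the further vertices. -/
def upperClass (L H : ℕ) (Q : ℕ → Finset ℕ) (r x : ℕ) : Prop :=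
  (r < H ∧ ¬ rightClass L r x) ∨ (H ≤ r ∧ ∀ p ∈ Q (r - H), x ∉ block p)

section Dyadic

theorem not_separated_of_dvd {L H p z c : ℕ} (h : z / 2 ^ (p + 1) = c / 2 ^ (p + 1))
    (hc : 2 ^ p ∣ c) : ¬ Separated H (leftClass L) (rightClass L) z c ∧
      ¬ Separated H (leftClass L) (rightClass L) c z := by
  have key : ∀ q, ¬ 2 ^ q ∣ c → z / 2 ^ q = c / 2 ^ q := by
    intro q hq
    have hpq : p + 1 ≤ q := by
      by_contra hlt
      exact hq ((pow_dvd_pow 2 (by omega)).trans hc)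
    obtain ⟨d, rfl⟩ := Nat.exists_eq_add_of_le hpq
    rw [pow_add, ← Nat.div_div_eq_div_mul, ← Nat.div_div_eq_div_mul, h]
  constructor
  · rintro ⟨q, -, ⟨hq, h1, -⟩, ⟨-, h2, h3⟩ | ⟨h2, -⟩⟩
    · rw [key q h3] at h1
      omega
    · omega
  · rintro ⟨q, -, ⟨hq, h1, h3⟩, ⟨-, h2, -⟩ | ⟨h2, -⟩⟩
    · rw [key q h3] at h2
      omega
    · omega

theorem exists_split {i j L : ℕ} (hij : i < j) (hj : j < 2 ^ L) :
    ∃ p < L, i / 2 ^ (p + 1) = j / 2 ^ (p + 1) ∧ i < j / 2 ^ p * 2 ^ p := by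
  classical
  have hex : ∃ m, i / 2 ^ m = j / 2 ^ m :=
    ⟨L, by rw [Nat.div_eq_of_lt hj, Nat.div_eq_of_lt (hij.trans hj)]⟩
  have hspec := Nat.find_spec hex
  have hle : Nat.find hex ≤ L :=
    Nat.find_le (by rw [Nat.div_eq_of_lt hj, Nat.div_eq_of_lt (hij.trans hj)])
  rcases hm : Nat.find hex with _ | p
  · rw [hm] at hspec
    simp at hspec
    omega
  · rw [hm] at hspec hle
    refine ⟨p, by omega, hspec, ?_⟩
    have hne := Nat.find_min hex (m := p) (by omega)
    have hlt : i / 2 ^ p < j / 2 ^ p := lt_of_le_of_ne (Nat.div_le_div_right hij.le) hne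
    exact (Nat.div_lt_iff_lt_mul (by positivity)).1 hlt

theorem split_div {j p : ℕ} : j / 2 ^ p * 2 ^ p / 2 ^ (p + 1) = j / 2 ^ (p + 1) := by
  rw [pow_succ, ← Nat.div_div_eq_div_mul, ← Nat.div_div_eq_div_mul,
    Nat.mul_div_cancel _ (by positivity)]

theorem not_separated_side {N L H i : ℕ} (hL : N ≤ 2 ^ L) (hi : i + 1 < N) :
    ¬ Separated H (leftClass L) (rightClass L) i (i + 1) := by
  obtain ⟨p, -, h1, h2⟩ := exists_split (Nat.lt_succ_self i) (hi.trans_le hL)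
  have h3 : (i + 1) / 2 ^ p * 2 ^ p = i + 1 := le_antisymm (Nat.div_mul_le_self _ _) h2
  exact (not_separated_of_dvd h1 (Dvd.intro_left _ h3)).1

theorem exists_not_separated {N L H i j : ℕ} (hL : N ≤ 2 ^ L) (hij : i + 2 ≤ j) (hj : j < N) :
    ∃ c, i < c ∧ c < j ∧ ¬ Separated H (leftClass L) (rightClass L) i c ∧
      ¬ Separated H (leftClass L) (rightClass L) c j := by
  obtain ⟨p, -, h1, h2⟩ := exists_split (by omega : i < j) (hj.trans_le hL)
  rcases (Nat.div_mul_le_self j (2 ^ p)).lt_or_eq with h3 | h3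
  · refine ⟨_, h2, h3, ?_, ?_⟩
    · exact (not_separated_of_dvd (h1.trans split_div.symm) (Dvd.intro_left _ rfl)).1
    · exact (not_separated_of_dvd split_div.symm (Dvd.intro_left _ rfl)).2
  · refine ⟨i + 1, by omega, by omega, not_separated_side hL (by omega), ?_⟩
    have h4 : (i + 1) / 2 ^ (p + 1) = j / 2 ^ (p + 1) := by
      apply le_antisymm (Nat.div_le_div_right (by omega))
      rw [← h1]
      exact Nat.div_le_div_right (by omega)
    exact (not_separated_of_dvd h4 (Dvd.intro_left _ h3)).1

/-- Every pair that is not separated has one end the dyadic split point determined by the other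
end and a scale. -/
theorem separated_of_ne {N L H i j : ℕ} (hLH : L ≤ H) (hL : N ≤ 2 ^ L) (hij : i < j) (hj : j < N)
    (h : ∀ p < L, i ≠ j / 2 ^ (p + 1) * 2 ^ (p + 1) ∧
      j ≠ i / 2 ^ (p + 1) * 2 ^ (p + 1) + 2 ^ p) :
    Separated H (leftClass L) (rightClass L) i j := by
  obtain ⟨p, hp, h1, h2⟩ := exists_split hij (hj.trans_le hL)
  obtain ⟨h3, h4⟩ := h p hp
  have hlt : i / 2 ^ p < j / 2 ^ p := (Nat.div_lt_iff_lt_mul (by positivity)).2 h2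
  have e : ∀ x, x / 2 ^ (p + 1) = x / 2 ^ p / 2 := fun x => by
    rw [pow_succ, ← Nat.div_div_eq_div_mul]
  have ei : i / 2 ^ p = 2 * (i / 2 ^ (p + 1)) := by
    have := e i; have := e j; omega
  have ej : j / 2 ^ p = 2 * (i / 2 ^ (p + 1)) + 1 := by
    have := e i; have := e j; omega
  refine ⟨p, by omega, ⟨hp, by omega, fun hd => h3 ?_⟩, Or.inl ⟨hp, by omega, fun hd => h4 ?_⟩⟩
  · have := Nat.div_mul_cancel hd
    rw [ei] at this
    rw [← h1]
    nth_rewrite 1 [← this]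
    rw [pow_succ]
    ring
  · have := Nat.div_mul_cancel hd
    rw [ej] at this
    rw [← this, pow_succ]
    ring

end Dyadic

section Instance

variable {N L P Y₀ : ℕ} {Q : ℕ → Finset ℕ}

theorem rightClass_block {p x : ℕ} : rightClass L (L + p) x ↔ x ∈ block p := by
  simp [rightClass]

theorem exists_saturatedBlocker_dyadic {n : ℕ} (hn : n = N + 3 * (L + P) + 3 + (L + P + Y₀))
    (hN : 0 < N) (hL : N ≤ 2 ^ L) (hQ : ∀ r, Q r ⊆ range P) (hQ₀ : Q Y₀ = ∅) :
    ∃ B : Finset (Sym2 (ZMod n)), IsSaturatedBlocker n B ∧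
      #B = #(removedPairs N (L + P) (L + P + Y₀) (leftClass L) (rightClass L)
        (upperClass L (L + P) Q)) := by
  apply exists_saturatedBlocker_removedPairs hn hN (by omega)
  · rintro q - x - ⟨⟨h1, h2, -⟩, ⟨-, h3, -⟩ | ⟨h3, -⟩⟩ <;> omega
  · intro x _
    right
    simp [hQ₀]
  · intro q hq x _
    simp only [upperClass]
    constructor
    · rintro (h | h)
      · exact h.2
      · omega
    · exact fun h => Or.inl ⟨hq, h⟩
  · intro r hr x _ hU
    by_cases hrH : r < L + P
    · have hg : rightClass L r x := by
        by_contra h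
        exact hU (Or.inl ⟨hrH, h⟩)
      refine ⟨r, hrH, hg, ?_⟩
      rintro x' - (h | h)
      · exact h.2
      · omega
    · simp only [upperClass, hrH, false_and, false_or, not_lt.1 hrH, true_and, not_forall,
        not_not] at hU
      obtain ⟨p, hp, hx⟩ := hU
      refine ⟨L + p, ?_, rightClass_block.2 hx, ?_⟩
      · have := mem_range.1 (hQ _ hp)
        omega
      · rintro x' - (h | h)
        · omega
        · rw [rightClass_block]
          exact h.2 p hp
  · exact fun i hi => not_separated_side hL hi
  · exact fun i j hij hj => exists_not_separated hL hij hj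

/-- Removal in the construction attached to `Q`. -/
def DyadicRemoved (N L P Y₀ : ℕ) (Q : ℕ → Finset ℕ) (i j : ℕ) : Prop :=
  Removed N (N + 3 * (L + P) + 3 + (L + P + Y₀))
    (StartRel N (L + P) (leftClass L) (upperClass L (L + P) Q))
    (EndRel N (L + P) (leftClass L) (rightClass L)) i j

theorem dyadicRemoved_of_lt {Q' : ℕ → Finset ℕ} {i j : ℕ} (hj : j < N + 4 * (L + P) + 2) :
    DyadicRemoved N L P Y₀ Q i j → DyadicRemoved N L P Y₀ Q' i j := by
  intro h
  have hij := h.1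
  by_cases hjN : j < N
  · rw [DyadicRemoved, removed_iff_separated (by omega) hij hjN] at h ⊢
    exact h
  · have key : ∀ x, StartRel N (L + P) (leftClass L) (upperClass L (L + P) Q) x j ↔
        StartRel N (L + P) (leftClass L) (upperClass L (L + P) Q') x j := by
      intro x
      have aux : ∀ r, j = N + 3 * (L + P) + 2 + r →
          (upperClass L (L + P) Q r x ↔ upperClass L (L + P) Q' r x) := by
        intro r hr
        have h1 : r < L + P := by omega
        have h2 : ¬ L + P ≤ r := by omega
        simp [upperClass, h1, h2]
      simp only [StartRel]
      grind
    rcases h with ⟨h1, h2, h3 | h3 | ⟨h3, x, hx, h4⟩⟩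
    · exact absurd h3.1 hjN
    · refine ⟨h1, h2, Or.inr (Or.inl ?_)⟩
      rw [← key]
      exact h3
    · refine ⟨h1, h2, Or.inr (Or.inr ⟨h3, x, hx, ?_⟩)⟩
      rw [← key]
      exact h4

theorem dyadicRemoved_last {i r : ℕ} (hr : r ≤ Y₀) (hP : 2 * (2 ^ P + P) ≤ N)
    (hQ : ∀ r, Q r ⊆ range P) :
    DyadicRemoved N L P Y₀ Q i (N + 4 * (L + P) + 2 + r) ↔
      (∃ p ∈ Q r, i ∈ block p) ∨ (N ≤ i ∧ i < N + 4 * (L + P) + 2 + r ∧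
        ∃ x < N, (∀ p ∈ Q r, x ∉ block p) ∧
          EndRel N (L + P) (leftClass L) (rightClass L) x i) := by
  have hA : ∀ x, StartRel N (L + P) (leftClass L) (upperClass L (L + P) Q) x
      (N + 4 * (L + P) + 2 + r) ↔ ∀ p ∈ Q r, x ∉ block p := by
    intro x
    rw [show N + 4 * (L + P) + 2 + r = N + 3 * (L + P) + 2 + (L + P + r) by ring, startRel_last]
    simp [upperClass]
  have hZ : ∀ x, ¬ EndRel N (L + P) (leftClass L) (rightClass L) x
      (N + 4 * (L + P) + 2 + r) := by
    intro x h
    rcases h.pos with h | ⟨q, hq, h⟩ <;> omega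
  simp only [DyadicRemoved, Removed, hA, hZ, not_false_eq_true, and_true]
  constructor
  · rintro ⟨h1, h2, h3 | h3 | h3⟩
    · omega
    · left
      simpa using h3.2.2
    · exact Or.inr ⟨h3.1, h1, h3.2⟩
  · rintro (⟨p, hp, hi⟩ | ⟨h1, h2, h3⟩)
    · have := lt_of_mem_block hP (mem_range.1 (hQ _ hp)) hi
      refine ⟨by omega, by omega, Or.inr (Or.inl ⟨this, by omega, ?_⟩)⟩
      simpa using ⟨p, hp, hi⟩
    · exact ⟨h2, by omega, Or.inr (Or.inr ⟨h1, h3⟩)⟩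

theorem zero_notMem_block {p : ℕ} : 0 ∉ block p := by
  rw [mem_block]
  have : 0 < 2 ^ p := by positivity
  omega

/-- Comparison with the construction attached to the empty family. -/
theorem dyadicRemoved_last_iff_empty {i r : ℕ} (hr : r ≤ Y₀) (hN : 0 < N)
    (hP : 2 * (2 ^ P + P) ≤ N) (hQ : ∀ r, Q r ⊆ range P) :
    DyadicRemoved N L P Y₀ Q i (N + 4 * (L + P) + 2 + r) ↔
      (DyadicRemoved N L P Y₀ (fun _ => ∅) i (N + 4 * (L + P) + 2 + r) ∧
        ∀ p ∈ Q r, i ≠ N + (L + P) + 2 + 2 * (L + p)) ∨ ∃ p ∈ Q r, i ∈ block p := by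
  rw [dyadicRemoved_last hr hP hQ, dyadicRemoved_last hr hP (by simp), or_comm]
  simp only [notMem_empty, false_and, exists_false, false_or, IsEmpty.forall_iff, implies_true,
    true_and]
  refine or_congr_left ?_
  constructor
  · rintro ⟨h1, h2, x, hx, hxQ, hZ⟩
    refine ⟨⟨h1, h2, x, hx, hZ⟩, ?_⟩
    rintro p hp rfl
    rw [endRel_hub (by have := mem_range.1 (hQ _ hp); omega), rightClass_block] at hZ
    exact hxQ p hp hZ
  · rintro ⟨⟨h1, h2, x, hx, hZ⟩, hi⟩
    refine ⟨h1, h2, ?_⟩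
    rcases hZ with h | ⟨q, hq, h, -⟩ | ⟨q, hq, h, hg⟩
    · exact ⟨0, hN, fun p _ => zero_notMem_block, Or.inl h⟩
    · exact ⟨0, hN, fun p _ => zero_notMem_block, Or.inr (Or.inl ⟨q, hq, h, by simp [leftClass]⟩)⟩
    · rcases hg with ⟨hqL, hodd, hdvd⟩ | ⟨hqL, hxb⟩
      · have h1q : 1 < 2 ^ q := by
          rcases q with _ | q
          · simp at hdvd
          · exact Nat.one_lt_two_pow (by omega)
        have hev : 2 ^ q % 2 = 0 := by
          rcases q with _ | q
          · simp at hdvd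
          · rw [pow_succ]; omega
        have hle : 2 ^ q ≤ x := by
          by_contra hlt
          rw [Nat.div_eq_of_lt (by omega)] at hodd
          omega
        have hne : x ≠ 2 ^ q := fun hx => hdvd (hx ▸ dvd_rfl)
        refine ⟨2 ^ q + 1, by omega, fun p _ hp => ?_,
          Or.inr (Or.inr ⟨q, hq, h, Or.inl ⟨hqL, ?_, ?_⟩⟩)⟩
        · rw [mem_block] at hp
          omega
        · rw [Nat.add_div_left _ (by positivity), Nat.div_eq_of_lt h1q]
        · rw [Nat.dvd_add_right dvd_rfl, Nat.dvd_one]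
          omega
      · refine ⟨x, hx, fun p hp hxp => hi p hp ?_, Or.inr (Or.inr ⟨q, hq, h, Or.inr ⟨hqL, hxb⟩⟩)⟩
        have := block_eq_of_mem hxb hxp
        omega

open Classical in
/-- The vertices joined to `j` by a removed pair from below. -/
noncomputable def column (N L P Y₀ : ℕ) (Q : ℕ → Finset ℕ) (j : ℕ) : Finset ℕ :=
  (range j).filter fun i => DyadicRemoved N L P Y₀ Q i j

theorem mem_column {i j : ℕ} : i ∈ column N L P Y₀ Q j ↔ DyadicRemoved N L P Y₀ Q i j := by
  simp only [column, mem_filter, mem_range, and_iff_right_iff_imp]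
  exact fun h => h.1

theorem card_column_last {r : ℕ} (hr : r ≤ Y₀) (hN : 0 < N)
    (hP : 2 * (2 ^ P + P) ≤ N) (hQ : ∀ r, Q r ⊆ range P) :
    #(column N L P Y₀ Q (N + 4 * (L + P) + 2 + r)) =
      #(column N L P Y₀ (fun _ => ∅) (N + 4 * (L + P) + 2 + r)) + ∑ p ∈ Q r, 2 ^ p := by
  set j := N + 4 * (L + P) + 2 + r with hj
  set hubs := (Q r).image fun p => N + (L + P) + 2 + 2 * (L + p) with hhubs
  have hlt : ∀ p ∈ Q r, p < P := fun p hp => mem_range.1 (hQ _ hp)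
  have heq : column N L P Y₀ Q j =
      (column N L P Y₀ (fun _ => ∅) j \ hubs) ∪ (Q r).biUnion block := by
    ext i
    rw [mem_column, dyadicRemoved_last_iff_empty hr hN hP hQ]
    simp only [mem_union, mem_sdiff, mem_column, hhubs, mem_image, mem_biUnion, not_exists, not_and]
    simp only [ne_comm, ne_eq, hj]
  have hdisj : Disjoint (column N L P Y₀ (fun _ => ∅) j \ hubs) ((Q r).biUnion block) := by
    rw [disjoint_left]
    intro i hi hi'
    rw [mem_sdiff, mem_column, dyadicRemoved_last hr hP (by simp)] at hi
    obtain ⟨p, hp, hip⟩ := mem_biUnion.1 hi'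
    have := lt_of_mem_block hP (hlt p hp) hip
    simp at hi
    omega
  have hsub : hubs ⊆ column N L P Y₀ (fun _ => ∅) j := by
    intro i hi
    obtain ⟨p, hp, rfl⟩ := mem_image.1 hi
    obtain ⟨x, hx⟩ := block_nonempty p
    have := hlt p hp
    rw [mem_column, dyadicRemoved_last hr hP (by simp)]
    refine Or.inr ⟨by omega, by omega, x, lt_of_mem_block hP this hx, by simp, ?_⟩
    rw [endRel_hub (by omega), rightClass_block]
    exact hx
  have hcard : #hubs = #(Q r) := card_image_of_injective _ fun a b h => by omega
  have hle := card_le_card hsub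
  rw [heq, card_union_of_disjoint hdisj, card_sdiff_of_subset hsub,
    card_biUnion fun p _ q _ h => disjoint_block h]
  simp only [card_block, sum_add_distrib, sum_const, smul_eq_mul, mul_one]
  omega

theorem card_removedPairs_eq_sum :
    #(removedPairs N (L + P) (L + P + Y₀) (leftClass L) (rightClass L)
        (upperClass L (L + P) Q)) =
      ∑ j ∈ range (N + 4 * (L + P) + 2 + (Y₀ + 1)), #(column N L P Y₀ Q j) := by
  rw [← card_sigma]
  refine card_bij' (fun p _ => ⟨p.2, p.1⟩) (fun p _ => (p.2, p.1)) ?_ ?_ ?_ ?_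
  · rintro ⟨i, j⟩ h
    rw [mem_removedPairs] at h
    simp only [mem_sigma, mem_range, mem_column]
    exact ⟨by have := h.2.1; omega, h⟩
  · rintro ⟨j, i⟩ h
    simp only [mem_sigma, mem_column] at h
    rw [mem_removedPairs]
    exact h.2
  · simp
  · simp

theorem card_removedPairs_eq_add (hN : 0 < N) (hP : 2 * (2 ^ P + P) ≤ N)
    (hQ : ∀ r, Q r ⊆ range P) (hQ₀ : Q Y₀ = ∅) :
    #(removedPairs N (L + P) (L + P + Y₀) (leftClass L) (rightClass L)
        (upperClass L (L + P) Q)) =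
      #(removedPairs N (L + P) (L + P + Y₀) (leftClass L) (rightClass L)
        (upperClass L (L + P) fun _ => ∅)) + ∑ r ∈ range Y₀, ∑ p ∈ Q r, 2 ^ p := by
  have hfirst : ∀ j ∈ range (N + 4 * (L + P) + 2),
      #(column N L P Y₀ Q j) = #(column N L P Y₀ (fun _ => ∅) j) := by
    intro j hj
    congr 1
    ext i
    rw [mem_column, mem_column]
    exact ⟨dyadicRemoved_of_lt (mem_range.1 hj), dyadicRemoved_of_lt (mem_range.1 hj)⟩
  have hlast : ∀ r ∈ range (Y₀ + 1), #(column N L P Y₀ Q (N + 4 * (L + P) + 2 + r)) =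
      #(column N L P Y₀ (fun _ => ∅) (N + 4 * (L + P) + 2 + r)) + ∑ p ∈ Q r, 2 ^ p :=
    fun r hr => card_column_last (Nat.lt_succ_iff.1 (mem_range.1 hr)) hN hP hQ
  rw [card_removedPairs_eq_sum, card_removedPairs_eq_sum,
    sum_range_add (fun j => #(column N L P Y₀ Q j)),
    sum_range_add (fun j => #(column N L P Y₀ (fun _ => ∅) j)), sum_congr rfl hfirst,
    sum_congr rfl hlast, sum_add_distrib, sum_range_succ (fun r => ∑ p ∈ Q r, 2 ^ p), hQ₀,
    sum_empty, add_zero, ← add_assoc]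

end Instance

/-- The pairs `i < j < N`. -/
def increasingPairs (N : ℕ) : Finset (ℕ × ℕ) :=
  (range N ×ˢ range N).filter fun p => p.1 < p.2

theorem card_increasingPairs (N : ℕ) : #(increasingPairs N) = N.choose 2 := by
  have h : #(increasingPairs N) = ∑ j ∈ range N, j := by
    calc #(increasingPairs N) = #((range N).sigma fun j => range j) := by
          refine card_bij' (fun p _ => ⟨p.2, p.1⟩) (fun p _ => (p.2, p.1)) ?_ ?_ ?_ ?_
          · rintro ⟨i, j⟩ h
            simp_all [increasingPairs]
          · rintro ⟨j, i⟩ h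
            simp only [mem_sigma, mem_range] at h
            simp only [increasingPairs, mem_filter, mem_product, mem_range]
            omega
          · simp
          · simp
      _ = ∑ j ∈ range N, j := by simp
  rw [h, sum_range_id, Nat.choose_two_right]

section Bounds

variable {N L P Y₀ : ℕ}

theorem choose_two_le_card_removedPairs (hL : N ≤ 2 ^ L) {U : ℕ → ℕ → Prop} :
    N.choose 2 ≤ #(removedPairs N (L + P) (L + P + Y₀) (leftClass L) (rightClass L) U) +
      2 * (N * L) := by
  classical
  set D := removedPairs N (L + P) (L + P + Y₀) (leftClass L) (rightClass L) U
  have hsub : increasingPairs N ⊆ D ∪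
      ((range N ×ˢ range L).image (fun q => (q.1 / 2 ^ (q.2 + 1) * 2 ^ (q.2 + 1), q.1)) ∪
        (range N ×ˢ range L).image
          fun q => (q.1, q.1 / 2 ^ (q.2 + 1) * 2 ^ (q.2 + 1) + 2 ^ q.2)) := by
    rintro ⟨i, j⟩ h
    simp only [increasingPairs, mem_filter, mem_product, mem_range] at h
    obtain ⟨⟨hi, hj⟩, hij⟩ := h
    by_contra hnot
    rw [mem_union, mem_union, not_or, not_or] at hnot
    obtain ⟨h1, h2, h3⟩ := hnot
    refine h1 (mem_removedPairs.2 ?_)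
    rw [removed_iff_separated (by omega) hij hj]
    refine separated_of_ne (by omega) hL hij hj fun p hp => ⟨fun h => h2 ?_, fun h => h3 ?_⟩
    · exact mem_image.2 ⟨(j, p), by simp [hj, hp], by rw [h]⟩
    · exact mem_image.2 ⟨(i, p), by simp [hi, hp], by rw [h]⟩
  have h1 := card_le_card hsub
  have h2 := card_union_le D
    ((range N ×ˢ range L).image (fun q => (q.1 / 2 ^ (q.2 + 1) * 2 ^ (q.2 + 1), q.1)) ∪
        (range N ×ˢ range L).image
          fun q => (q.1, q.1 / 2 ^ (q.2 + 1) * 2 ^ (q.2 + 1) + 2 ^ q.2))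
  have h3 := card_union_le
    ((range N ×ˢ range L).image (fun q => (q.1 / 2 ^ (q.2 + 1) * 2 ^ (q.2 + 1), q.1)))
    ((range N ×ˢ range L).image
          fun q => (q.1, q.1 / 2 ^ (q.2 + 1) * 2 ^ (q.2 + 1) + 2 ^ q.2))
  have h4 : ∀ f : ℕ × ℕ → ℕ × ℕ, #((range N ×ˢ range L).image f) ≤ N * L := fun f => by
    simpa using card_image_le (s := range N ×ˢ range L) (f := f)
  have h5 := h4 (fun q => (q.1 / 2 ^ (q.2 + 1) * 2 ^ (q.2 + 1), q.1))
  have h6 := h4 (fun q => (q.1, q.1 / 2 ^ (q.2 + 1) * 2 ^ (q.2 + 1) + 2 ^ q.2))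
  rw [card_increasingPairs] at h1
  omega

theorem card_removedPairs_le {n : ℕ} (hn : n = N + 3 * (L + P) + 3 + (L + P + Y₀)) :
    #(removedPairs N (L + P) (L + P + Y₀) (leftClass L) (rightClass L)
        (upperClass L (L + P) fun _ => ∅)) ≤ N.choose 2 + (7 * (L + P) + 4) * n := by
  have hsub : removedPairs N (L + P) (L + P + Y₀) (leftClass L) (rightClass L)
      (upperClass L (L + P) fun _ => ∅) ⊆ increasingPairs N ∪
        (range n ×ˢ Ico N (N + 4 * (L + P) + 2) ∪ Ico N (N + 3 * (L + P) + 2) ×ˢ range n) := by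
    rintro ⟨i, j⟩ h
    rw [mem_removedPairs] at h
    simp only [increasingPairs, mem_union, mem_filter, mem_product, mem_range, mem_Ico]
    obtain ⟨h1, h2, h3 | ⟨h3, h4, h5, -⟩ | ⟨h3, x, -, -, hZ⟩⟩ := h
    · omega
    · right; left
      refine ⟨by omega, h4, ?_⟩
      by_contra hlt
      refine h5 (Or.inr ⟨j - (N + 3 * (L + P) + 2), by omega, Or.inr ⟨by omega, by simp⟩⟩)
    · right; right
      refine ⟨⟨h3, ?_⟩, by omega⟩
      rcases hZ.pos with h | ⟨q, hq, h⟩ <;> omega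
  refine (card_le_card hsub).trans ((card_union_le _ _).trans ?_)
  rw [card_increasingPairs]
  refine Nat.add_le_add_left ((card_union_le _ _).trans ?_) _
  simp only [card_product, card_range, Nat.card_Ico]
  rw [show N + 4 * (L + P) + 2 - N = 4 * (L + P) + 2 by omega,
    show N + 3 * (L + P) + 2 - N = 3 * (L + P) + 2 by omega]
  linarith

end Bounds

theorem exists_sum_two_pow (P a : ℕ) (ha : a < 2 ^ P) :
    ∃ Q ⊆ range P, ∑ p ∈ Q, 2 ^ p = a := by
  refine ⟨a.bitIndices.toFinset, ?_, ?_⟩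
  · intro p hp
    have := Nat.two_pow_le_of_mem_bitIndices (List.mem_toFinset.1 hp)
    exact mem_range.2 ((Nat.pow_lt_pow_iff_right (by norm_num)).1 (this.trans_lt ha))
  · exact sum_toFinset_bitIndices_two_pow a

theorem exists_sum_eq_of_le (M Y δ : ℕ) (h : δ ≤ Y * M) :
    ∃ a : ℕ → ℕ, (∀ r, a r ≤ M) ∧ ∑ r ∈ range Y, a r = δ := by
  induction Y generalizing δ with
  | zero => exact ⟨0, by simp, by simp; omega⟩
  | succ Y ih =>
    obtain ⟨a, ha, hs⟩ := ih (min δ (Y * M)) (min_le_right _ _)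
    refine ⟨fun r => if r = Y then δ - min δ (Y * M) else a r, fun r => ?_, ?_⟩
    · dsimp only
      split_ifs
      · rw [add_mul, one_mul] at h
        omega
      · exact ha r
    · rw [sum_range_succ, if_pos rfl, sum_congr rfl fun r hr => if_neg (mem_range.1 hr).ne, hs]
      omega

/-- All sizes in a window around `N.choose 2` occur. -/
theorem exists_saturatedBlocker_window {n N L P Y₀ t : ℕ} (hn : n = N + 4 * (L + P) + 3 + Y₀)
    (hN : 0 < N) (hL : N ≤ 2 ^ L) (hP : 2 * (2 ^ P + P) ≤ N)
    (hlow : N.choose 2 + (7 * (L + P) + 4) * n ≤ t)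
    (hupp : t + 2 * (N * L) ≤ N.choose 2 + Y₀ * (2 ^ P - 1)) :
    ∃ B : Finset (Sym2 (ZMod n)), IsSaturatedBlocker n B ∧ #B = t := by
  have hn' : n = N + 3 * (L + P) + 3 + (L + P + Y₀) := by omega
  have h1 := card_removedPairs_le hn'
  have h2 := choose_two_le_card_removedPairs (P := P) (Y₀ := Y₀) hL
    (U := upperClass L (L + P) fun _ => ∅)
  obtain ⟨a, ha, hsum⟩ := exists_sum_eq_of_le (2 ^ P - 1) Y₀
    (t - #(removedPairs N (L + P) (L + P + Y₀) (leftClass L) (rightClass L)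
        (upperClass L (L + P) fun _ => ∅))) (by omega)
  have hpos : 0 < 2 ^ P := by positivity
  choose Q hQsub hQsum using fun r => exists_sum_two_pow P (a r) (by have := ha r; omega)
  obtain ⟨B, hB, hcard⟩ := exists_saturatedBlocker_dyadic (L := L) (P := P)
    (Q := fun r => if r = Y₀ then ∅ else Q r) hn' hN hL
    (fun r => by split_ifs <;> simp [hQsub]) (by simp)
  refine ⟨B, hB, hcard.trans ?_⟩
  rw [card_removedPairs_eq_add hN hP (fun r => by split_ifs <;> simp [hQsub]) (by simp),
    sum_congr rfl fun r hr => by rw [if_neg (mem_range.1 hr).ne, hQsum r], hsum]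
  omega

theorem mul_le_two_pow (m : ℕ) (hm : 17 ≤ m) : 4000 * (m + 1) ≤ 2 ^ m := by
  induction m, hm using Nat.le_induction with
  | base => norm_num
  | succ m _ ih => rw [pow_succ]; omega

theorem exists_choose_two_le (m : ℕ) : ∃ N, N.choose 2 ≤ m ∧ m < N.choose 2 + N := by
  classical
  have hex : ∃ k, m < k.choose 2 + k := ⟨m + 1, by omega⟩
  refine ⟨Nat.find hex, ?_, Nat.find_spec hex⟩
  rcases hk : Nat.find hex with _ | k
  · simp
  · have := Nat.find_min hex (m := k) (by omega)
    rw [Nat.choose_succ_succ' k 1, Nat.choose_one_right, one_add_one_eq_two]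
    omega

theorem two_mul_choose_two (N : ℕ) : 2 * N.choose 2 + N = N * N := by
  rcases N with _ | N
  · simp
  · rw [Nat.choose_two_right, Nat.mul_div_cancel' (Nat.even_mul_pred_self _).two_dvd]
    simp
    ring

/-- The range of sizes in integral form, with `L` the number of binary digits of `n`. -/
theorem exists_saturatedBlocker_of_digits {n L t : ℕ} (hL : 18 ≤ L) (hnlow : 2 ^ (L - 1) ≤ n)
    (hnupp : n < 2 ^ L) (htlow : n ^ 2 + 40 ≤ 4 * t + 8 * n)
    (htupp : 2 * t + 4000 * L * n < n ^ 2) :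
    ∃ B : Finset (Sym2 (ZMod n)), IsSaturatedBlocker n B ∧ #B = t := by
  have hbig : 4000 * L ≤ n := by
    have := mul_le_two_pow (L - 1) (by omega)
    rw [show L - 1 + 1 = L by omega] at this
    omega
  obtain ⟨P, rfl⟩ : ∃ P, L = P + 5 := ⟨L - 5, by omega⟩
  have e1 : 2 ^ (P + 5 - 1) = 16 * 2 ^ P := by
    rw [show P + 5 - 1 = P + 4 by omega, pow_add]; ring
  have e2 : 2 ^ (P + 5) = 32 * 2 ^ P := by rw [pow_add]; ring
  rw [e1] at hnlow
  set K := (7 * (P + 5 + P) + 4) * n with hK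
  have hKle : K ≤ 14 * (P + 5) * n := Nat.mul_le_mul_right _ (by omega)
  clear_value K
  have hKt : K ≤ t := by
    have h2 : 4000 * (P + 5) * n ≤ n * n := Nat.mul_le_mul_right _ hbig
    have h3 : 18 * n ≤ (P + 5) * n := Nat.mul_le_mul_right _ hL
    linarith
  obtain ⟨N, hN1, hN2⟩ := exists_choose_two_le (t - K)
  have hch := two_mul_choose_two N
  have hNlow : n ≤ 2 * N := by
    by_contra hlt
    have h1 : (2 * N + 1) * (2 * N + 1) ≤ n * n := Nat.mul_le_mul (by omega) (by omega)
    have h2 : 4000 * (P + 5) * n ≤ n * n := Nat.mul_le_mul_right _ hbig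
    have h3 : 18 * n ≤ (P + 5) * n := Nat.mul_le_mul_right _ hL
    have h4 : t < N.choose 2 + N + K := by omega
    linarith
  have hNupp : N + 2000 * (P + 5) ≤ n := by
    by_contra hlt
    obtain ⟨d, hd⟩ := Nat.exists_eq_add_of_le (show 2000 * (P + 5) ≤ n by omega)
    obtain ⟨e, rfl⟩ := Nat.exists_eq_add_of_le (show d + 1 ≤ N by omega)
    have h1 : d * d ≤ 2 * (d + 1 + e).choose 2 := by
      linarith [Nat.zero_le (d * e), Nat.zero_le (e * e)]
    have h2 : (d + 1 + e).choose 2 ≤ t := by omega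
    rw [hd] at htupp
    linarith [Nat.zero_le ((P + 5) * (P + 5))]
  obtain ⟨Y, hY⟩ := Nat.exists_eq_add_of_le (show N + 4 * (P + 5 + P) + 3 ≤ n by omega)
  refine exists_saturatedBlocker_window (L := P + 5) (P := P) hY (by omega) (by omega) (by omega)
    (by rw [← hK]; omega) ?_
  have hYlow : 1900 * (P + 5) ≤ Y := by linarith
  have hpow : n ≤ 64 * (2 ^ P - 1) := by
    rw [e2] at hnupp
    generalize 2 ^ P = x at hnupp
    omega
  have h1 : 1900 * (P + 5) * n ≤ Y * (64 * (2 ^ P - 1)) := Nat.mul_le_mul hYlow hpow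
  have h2 : N * (P + 5) ≤ (P + 5) * n := by
    rw [mul_comm]
    exact Nat.mul_le_mul_left _ (by omega)
  have h3 : N ≤ (P + 5) * n := by nlinarith
  have h4 : 64 * (17 * ((P + 5) * n)) ≤ 64 * (Y * (2 ^ P - 1)) := by nlinarith
  rw [mul_assoc] at hKle
  omega

end ConvexBlocker

open ConvexBlocker in
/-- there exist `C > 0` and `n₀` such that for every `n > n₀` and every `t` with
`4t ≥ n² - 8n + 40` and `t ≤ n²/2 - C·n·log n`, there is a saturated blocker of the convex
`n`-gon with exactly `t` edges. -/
theorem spectrum_fourth_range :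
    ∃ C : ℝ, 0 < C ∧ ∃ n₀ : ℕ, ∀ n : ℕ, n₀ < n → ∀ t : ℕ,
      n ^ 2 + 40 ≤ 4 * t + 8 * n → (t : ℝ) ≤ (n : ℝ) ^ 2 / 2 - C * n * Real.log n →
      ∃ B : Finset (Sym2 (ZMod n)), IsSaturatedBlocker n B ∧ B.card = t := by
  refine ⟨10000, by norm_num, 2 ^ 17, fun n hn t htlow htupp => ?_⟩
  have hn0 : n ≠ 0 := by omega
  have hm : 17 ≤ Nat.log 2 n := (Nat.le_log_iff_pow_le (by norm_num) hn0).2 hn.le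
  have hlow : 2 ^ Nat.log 2 n ≤ n := Nat.pow_log_le_self 2 hn0
  refine exists_saturatedBlocker_of_digits (L := Nat.log 2 n + 1) (by omega) (by simpa using hlow)
    (Nat.lt_pow_succ_log_self (by norm_num) n) htlow ?_
  set m := Nat.log 2 n
  have hnpos : (0 : ℝ) < n := by positivity
  have hlog : (m : ℝ) * Real.log 2 ≤ Real.log n := by
    rw [← Real.log_pow]
    exact Real.log_le_log (by positivity) (by exact_mod_cast hlow)
  have hm' : (17 : ℝ) ≤ m := by exact_mod_cast hm
  have hlogm : (m + 1 : ℝ) ≤ 2 * Real.log n := by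
    nlinarith [Real.log_two_gt_d9]
  have hmul : (m + 1 : ℝ) * n ≤ 2 * Real.log n * n := by gcongr
  have hfinal : (2 * t + 4000 * (m + 1) * n : ℝ) < (n : ℝ) ^ 2 := by nlinarith
  exact_mod_cast hfinal
end

section
/- Let n ≥ 5 and let B be a saturated blocker of size n−1 of the convex n-gon. If the ear-cover {i−1,i+1} does not belong to B, then deg_B(i) ≤ 2. -/
open Finset

namespace ConvexBlocker

/-- The chords `e` and `f`, written with increasing endpoints on a line, interleave. -/
def LinCross (e f : ℕ × ℕ) : Prop :=
  (e.1 < f.1 ∧ f.1 < e.2 ∧ e.2 < f.2) ∨ (f.1 < e.1 ∧ e.1 < f.2 ∧ f.2 < e.2)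

/-- `e` is a diagonal, written with increasing endpoints, of the convex polygon whose vertices
are the members of `S` in increasing order. -/
def LinDiagonal (S : Finset ℕ) (e : ℕ × ℕ) : Prop :=
  e.1 ∈ S ∧ e.2 ∈ S ∧ (∃ c ∈ S, e.1 < c ∧ c < e.2) ∧ ∃ d ∈ S, d < e.1 ∨ e.2 < d

/-- `T` is a maximal set of pairwise non-crossing diagonals of the convex polygon whose vertices
are the members of `S` in increasing order. -/
def LinTriangulation (S : Finset ℕ) (T : Finset (ℕ × ℕ)) : Prop :=
  (∀ e ∈ T, LinDiagonal S e) ∧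
  (∀ e ∈ T, ∀ f ∈ T, ¬ LinCross e f) ∧
  ∀ e, LinDiagonal S e → e ∉ T → ∃ f ∈ T, LinCross e f

/-- `p` and `q` are the neighbours in `S` of the vertex `v`. -/
def LinEar (S : Finset ℕ) (p v q : ℕ) : Prop :=
  p ∈ S ∧ q ∈ S ∧ p < v ∧ v < q ∧ ∀ x ∈ S, p < x → x < q → x = v

lemma LinTriangulation.insert_ear {S : Finset ℕ} {T : Finset (ℕ × ℕ)} {p v q : ℕ}
    (hS : 4 ≤ S.card) (hv : v ∈ S) (hear : LinEar S p v q)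
    (hT : LinTriangulation (S.erase v) T) : LinTriangulation S (insert (p, q) T) := by
  obtain ⟨hp, hq, hpv, hvq, huniq⟩ := hear
  obtain ⟨hdiag, hnc, hmax⟩ := hT
  obtain ⟨d, hd, hdout⟩ : ∃ d ∈ S, d ∉ ({p, v, q} : Finset ℕ) :=
    exists_mem_notMem_of_card_lt_card (card_le_three.trans_lt hS)
  have hear_diag : LinDiagonal S (p, q) := by
    refine ⟨hp, hq, ⟨v, hv, hpv, hvq⟩, d, hd, ?_⟩
    simp only [mem_insert, mem_singleton, not_or] at hdout
    have := huniq d hd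
    grind
  have hear_nc : ∀ e ∈ T, ¬ LinCross (p, q) e ∧ ¬ LinCross e (p, q) := by
    intro e he
    obtain ⟨h1, h2, -, -⟩ := hdiag e he
    have h3 := huniq e.1 (mem_of_mem_erase h1)
    have h4 := huniq e.2 (mem_of_mem_erase h2)
    simp only [mem_erase] at h1 h2
    unfold LinCross
    grind
  refine ⟨?_, ?_, ?_⟩
  · intro e he
    rcases mem_insert.1 he with rfl | he
    · exact hear_diag
    · obtain ⟨h1, h2, ⟨c, hc, hc'⟩, d, hd, hd'⟩ := hdiag e he
      exact ⟨mem_of_mem_erase h1, mem_of_mem_erase h2, ⟨c, mem_of_mem_erase hc, hc'⟩,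
        d, mem_of_mem_erase hd, hd'⟩
  · intro e he f hf
    rcases mem_insert.1 he with rfl | he <;> rcases mem_insert.1 hf with rfl | hf
    · unfold LinCross; grind
    · exact (hear_nc f hf).1
    · exact (hear_nc e he).2
    · exact hnc e he f hf
  · intro e hde he
    obtain ⟨h1, h2, ⟨c, hc, hc1, hc2⟩, d, hd, hd'⟩ := hde
    have hne : e ≠ (p, q) := fun h => he (h ▸ mem_insert_self _ _)
    have heT : e ∉ T := fun h => he (mem_insert_of_mem h)
    have hne' : ¬ (e.1 = p ∧ e.2 = q) := fun h => hne (Prod.ext h.1 h.2)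
    by_cases hev : e.1 = v ∨ e.2 = v
    · refine ⟨(p, q), mem_insert_self _ _, ?_⟩
      have h3 := huniq e.1 h1
      have h4 := huniq e.2 h2
      have h5 := huniq c hc
      unfold LinCross
      grind
    · have hin : ∃ c ∈ S.erase v, e.1 < c ∧ c < e.2 := by
        simp only [mem_erase]
        have h3 := huniq e.1 h1
        have h4 := huniq e.2 h2
        by_cases hcv : c = v
        · subst hcv
          by_cases e.1 < p
          · exact ⟨p, ⟨by omega, hp⟩, by omega, by omega⟩
          · exact ⟨q, ⟨by omega, hq⟩, by omega, by omega⟩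
        · exact ⟨c, ⟨hcv, hc⟩, hc1, hc2⟩
      have hout : ∃ d ∈ S.erase v, d < e.1 ∨ e.2 < d := by
        simp only [mem_erase]
        by_cases hdv : d = v
        · subst hdv
          rcases hd' with h | h
          · exact ⟨p, ⟨by omega, hp⟩, by omega⟩
          · exact ⟨q, ⟨by omega, hq⟩, by omega⟩
        · exact ⟨d, ⟨hdv, hd⟩, hd'⟩
      push Not at hev
      obtain ⟨f, hf, hcr⟩ := hmax e
        ⟨mem_erase.2 ⟨hev.1, h1⟩, mem_erase.2 ⟨hev.2, h2⟩, hin, hout⟩ heT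
      exact ⟨f, mem_insert_of_mem hf, hcr⟩

/-- The diagonals through a fixed vertex form a triangulation. -/
lemma exists_fan_triangulation {S : Finset ℕ} {v : ℕ} (hv : v ∈ S) :
    ∃ T, LinTriangulation S T ∧ ∀ e ∈ T, e.1 = v ∨ e.2 = v := by
  classical
  let T := {e ∈ S ×ˢ S | LinDiagonal S e ∧ (e.1 = v ∨ e.2 = v)}
  have hmem : ∀ e, e ∈ T ↔ LinDiagonal S e ∧ (e.1 = v ∨ e.2 = v) := by
    intro e
    simp only [T, mem_filter, mem_product, and_iff_right_iff_imp]
    exact fun h => ⟨h.1.1, h.1.2.1⟩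
  refine ⟨T, ⟨fun e he => ((hmem e).1 he).1, ?_, ?_⟩, fun e he => ((hmem e).1 he).2⟩
  · intro e he f hf
    have h1 := ((hmem e).1 he).2
    have h2 := ((hmem f).1 hf).2
    unfold LinCross
    omega
  · rintro ⟨a, b⟩ hd he
    have hne : ¬ (a = v ∨ b = v) := fun h => he ((hmem _).2 ⟨hd, h⟩)
    obtain ⟨ha, hb, ⟨c, hc, hc1, hc2⟩, d, hdS, hd'⟩ := hd
    dsimp only at *
    have key : ∀ x ∈ S, (x < v ∧ ((x < a ∧ a < v ∧ v < b) ∨ (a < x ∧ x < b ∧ b < v)) ∨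
        v < x ∧ ((v < a ∧ a < x ∧ x < b) ∨ (a < v ∧ v < b ∧ b < x))) →
        ∃ f ∈ T, LinCross (a, b) f := by
      rintro x hx (⟨hxv, h⟩ | ⟨hxv, h⟩)
      · refine ⟨(x, v), (hmem _).2 ⟨⟨hx, hv, ?_, ?_⟩, Or.inr rfl⟩, ?_⟩
        · rcases h with h | h
          · exact ⟨a, ha, by omega⟩
          · exact ⟨b, hb, by omega⟩
        · rcases h with h | h
          · exact ⟨b, hb, by omega⟩
          · exact ⟨a, ha, by omega⟩
        · simp only [LinCross]; omega
      · refine ⟨(v, x), (hmem _).2 ⟨⟨hv, hx, ?_, ?_⟩, Or.inl rfl⟩, ?_⟩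
        · rcases h with h | h
          · exact ⟨a, ha, by omega⟩
          · exact ⟨b, hb, by omega⟩
        · rcases h with h | h
          · exact ⟨b, hb, by omega⟩
          · exact ⟨a, ha, by omega⟩
        · simp only [LinCross]; omega
    by_cases hbet : a < v ∧ v < b
    · exact key d hdS (by omega)
    · exact key c hc (by omega)

/-- A set of fewer than `|S| - 2` pairs misses the cover of some ear at a vertex of `S`. -/
lemma exists_linEar_notMem {S : Finset ℕ} {B : Finset (ℕ × ℕ)} (hB : B.card + 2 < S.card) :
    ∃ p, ∃ v ∈ S, ∃ q, LinEar S p v q ∧ (p, q) ∉ B := by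
  by_contra! hcov
  have hne : S.Nonempty := card_pos.1 (by omega)
  have hex : ∀ v ∈ (S.erase (S.min' hne)).erase (S.max' hne), ∃ e ∈ B, LinEar S e.1 v e.2 := by
    intro v hv
    simp only [mem_erase] at hv
    obtain ⟨hvmax, hvmin, hvS⟩ := hv
    have hlow : {x ∈ S | x < v}.Nonempty := ⟨S.min' hne, mem_filter.2
      ⟨S.min'_mem hne, lt_of_le_of_ne (S.min'_le v hvS) (Ne.symm hvmin)⟩⟩
    have hupp : {x ∈ S | v < x}.Nonempty := ⟨S.max' hne, mem_filter.2
      ⟨S.max'_mem hne, lt_of_le_of_ne (S.le_max' v hvS) hvmax⟩⟩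
    have hp := mem_filter.1 (max'_mem _ hlow)
    have hq := mem_filter.1 (min'_mem _ hupp)
    have hear : LinEar S (max' _ hlow) v (min' _ hupp) := by
      refine ⟨hp.1, hq.1, hp.2, hq.2, fun x hx h1 h2 => ?_⟩
      rcases lt_trichotomy x v with h | h | h
      · exact absurd (le_max' _ x (mem_filter.2 ⟨hx, h⟩)) (not_le.2 h1)
      · exact h
      · exact absurd (min'_le _ x (mem_filter.2 ⟨hx, h⟩)) (not_le.2 h2)
    exact ⟨_, hcov _ v hvS _ hear, hear⟩
  choose! f hfB hfear using hex
  have hinj : Set.InjOn f ((S.erase (S.min' hne)).erase (S.max' hne) : Finset ℕ) := by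
    intro v hv w hw hvw
    have h1 := hfear v hv
    have h2 := hfear w hw
    rw [← hvw] at h2
    exact h2.2.2.2.2 v (mem_of_mem_erase (mem_of_mem_erase hv)) h1.2.2.1 h1.2.2.2.1
  have h1 := card_le_card_of_injOn f hfB hinj
  have h2 := pred_card_le_card_erase (s := S.erase (S.min' hne)) (a := S.max' hne)
  have h3 := pred_card_le_card_erase (s := S) (a := S.min' hne)
  omega

/-- Every blocker of an `m`-gon has at least `m - 2` edges. -/
lemma exists_linTriangulation_disjoint (S : Finset ℕ) (B : Finset (ℕ × ℕ))
    (hB : B.card + 2 < S.card) : ∃ T, LinTriangulation S T ∧ Disjoint B T := by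
  induction hm : S.card generalizing S B with
  | zero => omega
  | succ m ih =>
    by_cases hfan : ∃ v ∈ S, ∀ e ∈ B, ¬ (e.1 = v ∨ e.2 = v)
    · obtain ⟨v, hv, hvB⟩ := hfan
      obtain ⟨T, hT, hTv⟩ := exists_fan_triangulation hv
      exact ⟨T, hT, disjoint_left.2 fun e heB heT => hvB e heB (hTv e heT)⟩
    · push Not at hfan
      obtain ⟨p, v, hv, q, hear, hpq⟩ := exists_linEar_notMem hB
      obtain ⟨e, heB, hev⟩ := hfan v hv
      have hlt : {e ∈ B | ¬ (e.1 = v ∨ e.2 = v)}.card < B.card :=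
        card_lt_card (filter_ssubset.2 ⟨e, heB, not_not.2 hev⟩)
      have hcard := card_erase_of_mem hv
      obtain ⟨T, hT, hdisj⟩ := ih (S.erase v) {e ∈ B | ¬ (e.1 = v ∨ e.2 = v)}
        (by omega) (by omega)
      refine ⟨insert (p, q) T, hT.insert_ear (by omega) hv hear, ?_⟩
      refine disjoint_insert_right.2 ⟨hpq, disjoint_left.2 fun f hfB hfT => ?_⟩
      obtain ⟨h1, h2, -, -⟩ := hT.1 f hfT
      refine disjoint_left.1 hdisj (mem_filter.2 ⟨hfB, ?_⟩) hfT
      exact not_or.2 ⟨ne_of_mem_erase h1, ne_of_mem_erase h2⟩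

/-- The edge of the `n`-gon joining the vertices at positions `e.1` and `e.2`, counted from `o`. -/
def edgeAt (n : ℕ) (o : ZMod n) (e : ℕ × ℕ) : Sym2 (ZMod n) :=
  s(o + e.1, o + e.2)

section Transfer

variable {n : ℕ} {o : ZMod n}

lemma translate_inj {a b : ℕ} (ha : a < n) (hb : b < n)
    (h : o + (a : ZMod n) = o + (b : ZMod n)) : a = b := by
  have := congrArg ZMod.val (add_left_cancel h)
  rwa [ZMod.val_cast_of_lt ha, ZMod.val_cast_of_lt hb] at this

lemma edgeAt_injOn : Set.InjOn (edgeAt n o) {e | e.1 < e.2 ∧ e.2 < n} := by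
  rintro ⟨a, b⟩ ⟨hab, hb⟩ ⟨c, d⟩ ⟨hcd, hd⟩ h
  dsimp only at *
  rcases Sym2.eq_iff.1 h with ⟨h1, h2⟩ | ⟨h1, h2⟩
  · exact Prod.ext (translate_inj (by omega) (by omega) h1)
      (translate_inj (by omega) (by omega) h2)
  · have := translate_inj (by omega) (by omega) h1
    have := translate_inj (by omega) (by omega) h2
    dsimp only at *
    omega

lemma LinDiagonal.lt_and_lt {e : ℕ × ℕ} (he : LinDiagonal (range n) e) :
    e.1 < e.2 ∧ e.2 < n := by
  obtain ⟨-, h, ⟨c, -, h1, h2⟩, -⟩ := he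
  exact ⟨h1.trans h2, mem_range.1 h⟩

variable [NeZero n]

lemma val_sub_eq_ite (a b : ZMod n) :
    (b - a).val = if a.val ≤ b.val then b.val - a.val else b.val + n - a.val := by
  have ha := ZMod.val_lt a
  have hb := ZMod.val_lt b
  split_ifs with h
  · exact ZMod.val_sub h
  · have hba : b ≠ a := by rintro rfl; exact h le_rfl
    have : NeZero (a - b) := ⟨sub_ne_zero.2 hba.symm⟩
    rw [← neg_sub, ZMod.val_neg_of_ne_zero, ZMod.val_sub (by omega)]
    omega

lemma val_sub_translate (o : ZMod n) {a b : ℕ} (ha : a < n) (hb : b < n) :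
    ((o + b) - (o + a) : ZMod n).val = if a ≤ b then b - a else b + n - a := by
  rw [add_sub_add_left_eq_sub, val_sub_eq_ite, ZMod.val_cast_of_lt ha, ZMod.val_cast_of_lt hb]

lemma exists_position (o x : ZMod n) : ∃ k < n, x = o + (k : ZMod n) :=
  ⟨(x - o).val, ZMod.val_lt _, by simp⟩

lemma cross_edgeAt_iff {e f : ℕ × ℕ} (he : e.1 < e.2) (he' : e.2 < n) (hf : f.1 < f.2)
    (hf' : f.2 < n) : Cross n (edgeAt n o e) (edgeAt n o f) ↔ LinCross e f := by
  obtain ⟨a, b⟩ := e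
  obtain ⟨c, d⟩ := f
  dsimp only at *
  simp only [LinCross]
  have ha : a < n := by omega
  have hc : c < n := by omega
  constructor
  · rintro ⟨x, y, z, w, h1, h2, h3⟩
    rcases Sym2.eq_iff.1 h1 with ⟨rfl, rfl⟩ | ⟨rfl, rfl⟩ <;>
    rcases Sym2.eq_iff.1 h2 with ⟨rfl, rfl⟩ | ⟨rfl, rfl⟩ <;>
    · simp only [val_sub_translate o, ha, hc, he', hf'] at h3
      split_ifs at h3 <;> omega
  · rintro (h | h)
    · refine ⟨o + a, o + b, o + c, o + d, rfl, rfl, ?_⟩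
      simp only [val_sub_translate o, ha, hc, he', hf']
      split_ifs <;> omega
    · refine ⟨o + a, o + b, o + d, o + c, rfl, Sym2.eq_swap, ?_⟩
      simp only [val_sub_translate o, ha, hc, he', hf']
      split_ifs <;> omega

lemma isDiagonal_edgeAt {e : ℕ × ℕ} (he : LinDiagonal (range n) e) :
    IsDiagonal n (edgeAt n o e) := by
  obtain ⟨a, b⟩ := e
  obtain ⟨ha, hb, ⟨c, hc, hc1, hc2⟩, d, hd, hd'⟩ := he
  simp only [mem_range] at *
  refine ⟨o + a, o + b, rfl, fun h => ?_, ⟨o + c, ?_⟩, o + d, ?_⟩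
  · have := translate_inj ha hb h
    omega
  · simp only [Btw, val_sub_translate o, ha, hb, hc]
    split_ifs <;> omega
  · simp only [Btw, val_sub_translate o, ha, hb, hd]
    split_ifs <;> omega

lemma exists_linDiagonal_of_isDiagonal (o : ZMod n) {e : Sym2 (ZMod n)} (he : IsDiagonal n e) :
    ∃ e', LinDiagonal (range n) e' ∧ edgeAt n o e' = e := by
  obtain ⟨x, y, rfl, hxy, ⟨z, hz⟩, w, hw⟩ := he
  obtain ⟨a, ha, rfl⟩ := exists_position o x
  obtain ⟨b, hb, rfl⟩ := exists_position o y
  obtain ⟨c, hc, rfl⟩ := exists_position o z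
  obtain ⟨d, hd, rfl⟩ := exists_position o w
  have hab : a ≠ b := by rintro rfl; exact hxy rfl
  simp only [Btw, val_sub_translate o, ha, hb, hc, hd] at hz hw
  rcases hab.lt_or_gt with h | h
  · refine ⟨(a, b), ⟨mem_range.2 ha, mem_range.2 hb, ⟨c, mem_range.2 hc, ?_⟩,
      d, mem_range.2 hd, ?_⟩, rfl⟩ <;> split_ifs at hz hw <;> dsimp only <;> omega
  · refine ⟨(b, a), ⟨mem_range.2 hb, mem_range.2 ha, ⟨d, mem_range.2 hd, ?_⟩,
      c, mem_range.2 hc, ?_⟩, Sym2.eq_swap⟩ <;> split_ifs at hz hw <;> dsimp only <;> omega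

lemma LinTriangulation.isTriangulation_image {T : Finset (ℕ × ℕ)}
    (hT : LinTriangulation (range n) T) : IsTriangulation n (T.image (edgeAt n o)) := by
  obtain ⟨hdiag, hnc, hmax⟩ := hT
  refine ⟨?_, ?_, ?_⟩
  · simp only [forall_mem_image]
    exact fun e he => isDiagonal_edgeAt (hdiag e he)
  · simp only [forall_mem_image]
    intro e he f hf
    have h1 := (hdiag e he).lt_and_lt
    have h2 := (hdiag f hf).lt_and_lt
    rw [cross_edgeAt_iff h1.1 h1.2 h2.1 h2.2]
    exact hnc e he f hf
  · intro e he hmem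
    obtain ⟨e, hd, rfl⟩ := exists_linDiagonal_of_isDiagonal o he
    obtain ⟨f, hf, hcr⟩ := hmax e hd fun h => hmem (mem_image_of_mem _ h)
    have h1 := hd.lt_and_lt
    have h2 := (hdiag f hf).lt_and_lt
    exact ⟨_, mem_image_of_mem _ hf, (cross_edgeAt_iff h1.1 h1.2 h2.1 h2.2).2 hcr⟩

end Transfer

end ConvexBlocker

open ConvexBlocker in
/-- if the ear-cover `{i-1,i+1}` does not belong to a saturated blocker `B` of
size `n-1` of the convex `n`-gon, then `deg_B(i) ≤ 2`. -/
theorem deg_le_two_of_uncovered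
    (n : ℕ) (hn : 5 ≤ n) (B : Finset (Sym2 (ZMod n)))
    (hB : IsSaturatedBlocker n B) (hcard : B.card = n - 1)
    (i : ZMod n) (hi : s(i - 1, i + 1) ∉ B) :
    degB n B i ≤ 2 := by
  have : NeZero n := ⟨by omega⟩
  by_contra! hdeg
  unfold degB at hdeg
  -- Positions are counted from `i - 1`, so that `i` sits at position `1`.
  let B' := {e ∈ range n ×ˢ range n |
    e.1 < e.2 ∧ e.1 ≠ 1 ∧ e.2 ≠ 1 ∧ edgeAt n (i - 1) e ∈ B}
  have hpos : ∀ k < n, i = i - 1 + (k : ZMod n) → k = 1 := by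
    intro k hk h
    refine translate_inj (o := i - 1) hk (by omega) ?_
    rw [← h]; simp
  have hB' : B'.card ≤ {e ∈ B | i ∉ e}.card := by
    refine card_le_card_of_injOn (edgeAt n (i - 1)) ?_ (edgeAt_injOn.mono ?_)
    · rintro e he
      obtain ⟨h0, -, h1, h2, h3⟩ := mem_filter.1 he
      simp only [mem_product, mem_range] at h0
      refine mem_coe.2 (mem_filter.2 ⟨h3, fun h => ?_⟩)
      rcases Sym2.mem_iff.1 h with h | h
      · exact h1 (hpos _ h0.1 h)
      · exact h2 (hpos _ h0.2 h)
    · rintro e he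
      obtain ⟨h0, h, -⟩ := mem_filter.1 he
      exact ⟨h, mem_range.1 (mem_product.1 h0).2⟩
  have hsplit := card_filter_add_card_filter_not (s := B) (fun e => i ∈ e)
  have hone : 1 ∈ range n := mem_range.2 (by omega)
  have herase : ((range n).erase 1).card = n - 1 := by
    rw [card_erase_of_mem hone, card_range]
  obtain ⟨T, hT, hdisj⟩ := exists_linTriangulation_disjoint ((range n).erase 1) B' (by omega)
  have hear : LinEar (range n) 0 1 2 :=
    ⟨mem_range.2 (by omega), mem_range.2 (by omega), by omega, by omega, fun x _ _ _ => by omega⟩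
  have hT' := hT.insert_ear (by rw [card_range]; omega) hone hear
  obtain ⟨e, he⟩ := hB.1.2 _ (hT'.isTriangulation_image (o := i - 1))
  obtain ⟨heB, heT⟩ := mem_inter.1 he
  obtain ⟨f, hf, rfl⟩ := mem_image.1 heT
  rcases mem_insert.1 hf with rfl | hfT
  · refine hi ?_
    have h2 : i - 1 + 2 = i + 1 := by ring
    simpa only [edgeAt, Nat.cast_zero, add_zero, Nat.cast_ofNat, h2] using heB
  · have h1 := (hT'.1 f hf).lt_and_lt
    obtain ⟨h2, h3, -, -⟩ := hT.1 f hfT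
    simp only [mem_erase] at h2 h3
    exact disjoint_left.1 hdisj
      (mem_filter.2 ⟨mem_product.2 ⟨h2.2, h3.2⟩, h1.1, h2.1, h3.1, heB⟩) hfT
end
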